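/- Every singular holomorphic foliation germ 𝓕 at (ℂ²,0) admits at least one separatrix: an irreducible analytic invariant curve germ through the origin (Camacho–Sad theorem). -/

import Mathlib

open Filter Topology

/-- Germ divisibility at a point: `f` divides `g` as germs of holomorphic functions at `x`. -/
def DivGermAt (f g : ℂ × ℂ → ℂ) (x : ℂ × ℂ) : Prop :=
  ∃ u : ℂ × ℂ → ℂ, AnalyticAt ℂ u x ∧ ∀ᶠ q in 𝓝 x, g q = f q * u q

/-- `f` defines an irreducible germ of plane curve at the origin: `f` is holomorphic at `0`,
vanishes at `0`, is not the zero germ, and admits no factorization into two non-unit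
(i.e. vanishing at `0`) holomorphic germs. -/
def IrredGermAt (f : ℂ × ℂ → ℂ) : Prop :=
  AnalyticAt ℂ f 0 ∧ f 0 = 0 ∧ ¬ (∀ᶠ q in 𝓝 (0 : ℂ × ℂ), f q = 0) ∧
    ¬ ∃ g h : ℂ × ℂ → ℂ, AnalyticAt ℂ g 0 ∧ AnalyticAt ℂ h 0 ∧ g 0 = 0 ∧ h 0 = 0 ∧
        ∀ᶠ q in 𝓝 (0 : ℂ × ℂ), f q = g q * h q

/-- The curve `f = 0` is invariant for the foliation `ω = a dx + b dy`:
`f` divides `a ∂f/∂y − b ∂f/∂x`. -/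
def InvariantCurve (a b f : ℂ × ℂ → ℂ) : Prop :=
  ∃ h : ℂ × ℂ → ℂ, AnalyticAt ℂ h 0 ∧
    ∀ᶠ q in 𝓝 (0 : ℂ × ℂ),
      a q * fderiv ℂ f q (0, 1) - b q * fderiv ℂ f q (1, 0) = f q * h q

/-- A separatrix of the foliation `a dx + b dy`: an irreducible invariant analytic curve germ
through the origin. -/
def Separatrix (a b f : ℂ × ℂ → ℂ) : Prop :=
  IrredGermAt f ∧ InvariantCurve a b f

/-- The ramification of order `n`. -/
def ram (n : ℕ) : ℂ × ℂ → ℂ × ℂ := fun p => (p.1 ^ n, p.2)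

section

open Metric Set

attribute [local fun_prop] analyticAt_fst analyticAt_snd

theorem isUnit_of_forall_ne_zero {X : Type*} [TopologicalSpace X] [CompactSpace X]
    (f : C(X, ℂ)) (hf : ∀ x, f x ≠ 0) : IsUnit f :=
  ContinuousMap.isUnit_iff_forall_ne_zero f |>.mpr hf

theorem ContinuousMap.ringInverse_apply {X : Type*} [TopologicalSpace X] [CompactSpace X]
    (f : C(X, ℂ)) (hf : ∀ x, f x ≠ 0) (x : X) : Ring.inverse f x = (f x)⁻¹ := by
  have h := Ring.mul_inverse_cancel f (isUnit_of_forall_ne_zero f hf)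
  have hx := congrArg (fun g : C(X, ℂ) => g x) h
  simp only [ContinuousMap.mul_apply, ContinuousMap.one_apply] at hx
  exact eq_inv_of_mul_eq_one_right hx

/-- Continuous functions on the torus of radius `r`. -/
abbrev TorusFun (r : ℝ) : Type := C(sphere (0 : ℂ) r × sphere (0 : ℂ) r, ℂ)

/-- Integration over a torus against a continuous weight, as a continuous linear functional. -/
theorem exists_torus_functional {r : ℝ} (hr : 0 ≤ r) (w : ℝ → ℝ → ℂ)
    (hw : Continuous (Function.uncurry w)) :
    ∃ Λ : TorusFun r →L[ℂ] ℂ, ∀ g,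
      Λ g = ∫ θ in (0 : ℝ)..(2 * Real.pi), ∫ η in (0 : ℝ)..(2 * Real.pi),
        w θ η * g (⟨circleMap 0 r θ, circleMap_mem_sphere 0 hr θ⟩,
          ⟨circleMap 0 r η, circleMap_mem_sphere 0 hr η⟩) := by
  have hcont : ∀ g : TorusFun r,
      Continuous (Function.uncurry fun θ η : ℝ =>
        w θ η * g (⟨circleMap 0 r θ, circleMap_mem_sphere 0 hr θ⟩,
          ⟨circleMap 0 r η, circleMap_mem_sphere 0 hr η⟩)) := by
    intro g
    refine hw.mul (g.continuous.comp (Continuous.prodMk ?_ ?_))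
    · exact Continuous.subtype_mk ((continuous_circleMap 0 r).comp continuous_fst) _
    · exact Continuous.subtype_mk ((continuous_circleMap 0 r).comp continuous_snd) _
  have hcont1 := fun g => intervalIntegral.continuous_parametric_intervalIntegral_of_continuous'
    (μ := MeasureTheory.volume) (hcont g) 0 (2 * Real.pi)
  obtain ⟨M, hM⟩ := ((isCompact_uIcc (a := (0 : ℝ)) (b := 2 * Real.pi)).prod
    (isCompact_uIcc (a := (0 : ℝ)) (b := 2 * Real.pi))).exists_bound_of_continuousOn
      hw.continuousOn
  refine ⟨LinearMap.mkContinuous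
    { toFun := fun g => ∫ θ in (0 : ℝ)..(2 * Real.pi), ∫ η in (0 : ℝ)..(2 * Real.pi),
        w θ η * g (⟨circleMap 0 r θ, circleMap_mem_sphere 0 hr θ⟩,
          ⟨circleMap 0 r η, circleMap_mem_sphere 0 hr η⟩)
      map_add' := ?_
      map_smul' := ?_ } (M * |2 * Real.pi - 0| * |2 * Real.pi - 0|) ?_, fun g => rfl⟩
  · intro f g
    rw [← intervalIntegral.integral_add ((hcont1 f).intervalIntegrable _ _)
      ((hcont1 g).intervalIntegrable _ _)]
    congr 1
    ext θ
    refine Eq.trans ?_ (intervalIntegral.integral_add (((hcont f).comp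
      (Continuous.prodMk_right θ)).intervalIntegrable _ _)
      (((hcont g).comp (Continuous.prodMk_right θ)).intervalIntegrable _ _))
    congr 1
    ext η
    simp [mul_add]
  · intro c g
    simp only [RingHom.id_apply, smul_eq_mul, ← intervalIntegral.integral_const_mul,
      ContinuousMap.smul_apply]
    congr 1; ext θ; congr 1; ext η; ring
  · intro g
    simp only [LinearMap.coe_mk, AddHom.coe_mk]
    have key : ∀ θ ∈ Set.uIoc (0 : ℝ) (2 * Real.pi),
        ‖∫ η in (0 : ℝ)..(2 * Real.pi),
        w θ η * g (⟨circleMap 0 r θ, circleMap_mem_sphere 0 hr θ⟩,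
          ⟨circleMap 0 r η, circleMap_mem_sphere 0 hr η⟩)‖ ≤ M * ‖g‖ * |2 * Real.pi - 0| := by
      intro θ hθ
      refine intervalIntegral.norm_integral_le_of_norm_le_const fun η hη => ?_
      rw [norm_mul]
      have h1 := hM (θ, η) ⟨Set.uIoc_subset_uIcc hθ, Set.uIoc_subset_uIcc hη⟩
      exact mul_le_mul h1 (g.norm_coe_le_norm _) (norm_nonneg _) ((norm_nonneg _).trans h1)
    refine (intervalIntegral.norm_integral_le_of_norm_le_const key).trans (le_of_eq ?_)
    ring

/-- A Cauchy-type integral over a torus depends analytically on the point. -/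
theorem analyticAt_torus_cauchy (n : ℕ) {r : ℝ} (hr : 0 < r) (q : ℂ × ℂ → ℂ)
    (hq : ContinuousOn q (sphere 0 r ×ˢ sphere 0 r)) :
    AnalyticAt ℂ (fun p : ℂ × ℂ => ∮ τ in C(0, r), ∮ w in C(0, r),
      q (τ, w) * (τ ^ (n - 1) * (τ ^ n - p.1)⁻¹) * (w - p.2)⁻¹) 0 := by
  obtain ⟨Λ, hΛ⟩ := exists_torus_functional hr.le
    (fun θ η => deriv (circleMap 0 r) θ * deriv (circleMap 0 r) η *
      q (circleMap 0 r θ, circleMap 0 r η)) (by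
      have hc : Continuous fun z : ℝ × ℝ => q (circleMap 0 r z.1, circleMap 0 r z.2) := by
        refine hq.comp_continuous (by fun_prop) fun z => ?_
        exact ⟨circleMap_mem_sphere 0 hr.le _, circleMap_mem_sphere 0 hr.le _⟩
      simp only [deriv_circleMap]
      exact Continuous.mul (by fun_prop) hc)
  let i₁ : TorusFun r := ⟨fun s => s.1.1, by fun_prop⟩
  let i₂ : TorusFun r := ⟨fun s => s.2.1, by fun_prop⟩
  have hns : ∀ s : sphere (0 : ℂ) r, ‖(s : ℂ)‖ = r := fun s => by simp
  have ne₁ : ∀ x : ℂ, ‖x‖ < r ^ n → ∀ s, (i₁ ^ n - x • (1 : TorusFun r)) s ≠ 0 := by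
    intro x hx s h
    have : (s.1 : ℂ) ^ n = x := by simpa [i₁, sub_eq_zero] using h
    rw [← this, norm_pow, hns] at hx
    exact lt_irrefl _ hx
  have ne₂ : ∀ x : ℂ, ‖x‖ < r → ∀ s, (i₂ - x • (1 : TorusFun r)) s ≠ 0 := by
    intro x hx s h
    have : (s.2 : ℂ) = x := by simpa [i₂, sub_eq_zero] using h
    rw [← this, hns] at hx
    exact lt_irrefl _ hx
  have hA : AnalyticAt ℂ (fun p : ℂ × ℂ => Λ (i₁ ^ (n - 1) *
      Ring.inverse (i₁ ^ n - p.1 • (1 : TorusFun r)) *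
        Ring.inverse (i₂ - p.2 • (1 : TorusFun r)))) 0 := by
    refine (Λ.analyticAt _).comp ?_
    have e₁ : AnalyticAt ℂ (fun p : ℂ × ℂ => i₁ ^ n - p.1 • (1 : TorusFun r)) 0 := by fun_prop
    have e₂ : AnalyticAt ℂ (fun p : ℂ × ℂ => i₂ - p.2 • (1 : TorusFun r)) 0 := by fun_prop
    have u₁ := isUnit_of_forall_ne_zero _ (ne₁ 0 (by simpa using pow_pos hr n))
    have u₂ := isUnit_of_forall_ne_zero _ (ne₂ 0 (by simpa using hr))
    have a₁ : AnalyticAt ℂ (fun p : ℂ × ℂ => Ring.inverse (i₁ ^ n - p.1 • (1 : TorusFun r))) 0 :=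
      AnalyticAt.fun_comp (g := Ring.inverse) (by
        have := analyticAt_inverse (𝕜 := ℂ) u₁.unit
        simpa using this) e₁
    have a₂ : AnalyticAt ℂ (fun p : ℂ × ℂ => Ring.inverse (i₂ - p.2 • (1 : TorusFun r))) 0 :=
      AnalyticAt.fun_comp (g := Ring.inverse) (by
        have := analyticAt_inverse (𝕜 := ℂ) u₂.unit
        simpa using this) e₂
    exact (analyticAt_const.mul a₁).mul a₂
  refine hA.congr ?_
  have h1 : ∀ᶠ p : ℂ × ℂ in 𝓝 0, ‖p.1‖ < r ^ n :=
    (continuous_fst.norm).continuousAt.eventually_lt_const (by simpa using pow_pos hr n)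
  have h2 : ∀ᶠ p : ℂ × ℂ in 𝓝 0, ‖p.2‖ < r :=
    (continuous_snd.norm).continuousAt.eventually_lt_const (by simpa using hr)
  filter_upwards [h1, h2] with p hp1 hp2
  rw [hΛ]
  simp only [circleIntegral, smul_eq_mul, ← intervalIntegral.integral_const_mul,
    ContinuousMap.mul_apply, ContinuousMap.ringInverse_apply _ (ne₁ _ hp1),
    ContinuousMap.ringInverse_apply _ (ne₂ _ hp2)]
  congr 1; ext θ; congr 1; ext η
  simp [i₁, i₂]
  ring

theorem sum_inv_sub_root_mul {n : ℕ} (hn : n ≠ 0) {τ t : ℂ} (h : ‖t‖ < ‖τ‖) :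
    ∑ ζ ∈ Polynomial.nthRootsFinset n (1 : ℂ), (τ - ζ * t)⁻¹ =
      n * (τ ^ (n - 1) * (τ ^ n - t ^ n)⁻¹) := by
  have hprod := fun x : ℂ => IsPrimitiveRoot.pow_sub_pow_eq_prod_sub_mul x t
    (Nat.pos_of_ne_zero hn) (Complex.isPrimitiveRoot_exp n hn)
  have hne : τ ^ n - t ^ n ≠ 0 := by
    intro h0
    have := congrArg norm (sub_eq_zero.mp h0)
    rw [norm_pow, norm_pow] at this
    exact (pow_lt_pow_left₀ h (norm_nonneg _) hn).ne' this
  have hne' : ∀ ζ ∈ Polynomial.nthRootsFinset n (1 : ℂ), τ - ζ * t ≠ 0 := by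
    rw [hprod τ, Finset.prod_ne_zero_iff] at hne
    exact hne
  have hl := logDeriv_prod (f := fun (ζ : ℂ) (x : ℂ) => x - ζ * t) (x := τ) hne'
    (fun ζ _ => by fun_prop)
  rw [show (fun x : ℂ => ∏ ζ ∈ Polynomial.nthRootsFinset n (1 : ℂ), (x - ζ * t)) =
    fun x => x ^ n - t ^ n from funext fun x => (hprod x).symm] at hl
  simp only [logDeriv_apply, deriv_sub_const, deriv_id'', deriv_pow_field, one_div] at hl
  rw [← hl]
  field_simp

theorem norm_of_mem_nthRootsFinset {n : ℕ} (hn : n ≠ 0) {ζ : ℂ}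
    (hζ : ζ ∈ Polynomial.nthRootsFinset n (1 : ℂ)) : ‖ζ‖ = 1 :=
  Complex.norm_eq_one_of_pow_eq_one
    ((Polynomial.mem_nthRootsFinset (Nat.pos_of_ne_zero hn) _).mp hζ) hn

/-- The average of a separately holomorphic function over the rotations of order `n` in the first
variable descends to an analytic function of `(x ^ n, y)`. -/
theorem exists_analyticAt_average {n : ℕ} (hn : n ≠ 0) {r : ℝ} (hr : 0 < r) {q : ℂ × ℂ → ℂ}
    (hc : ContinuousOn q (sphere 0 r ×ˢ sphere 0 r))
    (hy : ∀ τ ∈ sphere (0 : ℂ) r, DiffContOnCl ℂ (fun w => q (τ, w)) (ball 0 r))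
    (hx : ∀ y ∈ ball (0 : ℂ) r, DiffContOnCl ℂ (fun τ => q (τ, y)) (ball 0 r)) :
    ∃ Q : ℂ × ℂ → ℂ, AnalyticAt ℂ Q 0 ∧ ∀ t ∈ ball (0 : ℂ) r, ∀ y ∈ ball (0 : ℂ) r,
      n * Q (t ^ n, y) = ∑ ζ ∈ Polynomial.nthRootsFinset n (1 : ℂ), q (ζ * t, y) := by
  have hpi : (2 * Real.pi * Complex.I : ℂ) ≠ 0 := Complex.two_pi_I_ne_zero
  refine ⟨fun p => ((2 * Real.pi * Complex.I : ℂ)⁻¹ * (2 * Real.pi * Complex.I : ℂ)⁻¹) * _,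
    analyticAt_const.mul (analyticAt_torus_cauchy n hr q hc), fun t ht y hyr => ?_⟩
  have hinner : ∀ τ ∈ sphere (0 : ℂ) r,
      (∮ w in C(0, r), q (τ, w) * (τ ^ (n - 1) * (τ ^ n - t ^ n)⁻¹) * (w - y)⁻¹) =
      (2 * Real.pi * Complex.I : ℂ) * (n : ℂ)⁻¹ *
        ∑ ζ ∈ Polynomial.nthRootsFinset n (1 : ℂ), (τ - ζ * t)⁻¹ * q (τ, y) := by
    intro τ hτ
    have h := (hy τ hτ).circleIntegral_sub_inv_smul hyr
    rw [← Finset.sum_mul, sum_inv_sub_root_mul hn (by simp at ht hτ; rw [hτ]; exact ht)]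
    have e : ∀ w, q (τ, w) * (τ ^ (n - 1) * (τ ^ n - t ^ n)⁻¹) * (w - y)⁻¹ =
      (τ ^ (n - 1) * (τ ^ n - t ^ n)⁻¹) * ((w - y)⁻¹ • q (τ, w)) := fun w => by
        rw [smul_eq_mul]; ring
    simp only [e, circleIntegral.integral_const_mul]
    rw [h, smul_eq_mul]
    have : (n : ℂ) ≠ 0 := by exact_mod_cast hn
    field_simp
  have hmem : ∀ ζ ∈ Polynomial.nthRootsFinset n (1 : ℂ), ζ * t ∈ ball (0 : ℂ) r := by
    intro ζ hζ
    simpa [norm_of_mem_nthRootsFinset hn hζ] using ht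
  simp only
  rw [circleIntegral.integral_congr hr.le hinner, circleIntegral.integral_const_mul,
    circleIntegral.integral_fun_sum]
  · have hsum : ∀ ζ ∈ Polynomial.nthRootsFinset n (1 : ℂ),
        (∮ τ in C(0, r), (τ - ζ * t)⁻¹ * q (τ, y)) =
          (2 * Real.pi * Complex.I : ℂ) * q (ζ * t, y) := fun ζ hζ =>
      (hx y hyr).circleIntegral_sub_inv_smul (hmem ζ hζ)
    rw [Finset.sum_congr rfl hsum, ← Finset.mul_sum]
    have : (n : ℂ) ≠ 0 := by exact_mod_cast hn
    generalize ∑ ζ ∈ Polynomial.nthRootsFinset n (1 : ℂ), q (ζ * t, y) = s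
    field_simp
  · intro ζ hζ
    refine ContinuousOn.circleIntegrable hr.le (ContinuousOn.mul ?_ ?_)
    · refine ContinuousOn.inv₀ (by fun_prop) fun τ hτ h0 => ?_
      have := hmem ζ hζ
      rw [← sub_eq_zero.mp h0] at this
      simp at hτ this
      exact this.ne hτ
    · exact (hx y hyr).continuousOn_ball.mono sphere_subset_closedBall

theorem analyticAt_comp_prodMk {F : ℂ × ℂ → ℂ} {u v : ℂ → ℂ} {z : ℂ}
    (hF : AnalyticAt ℂ F (u z, v z)) (hu : AnalyticAt ℂ u z) (hv : AnalyticAt ℂ v z) :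
    AnalyticAt ℂ (fun s => F (u s, v s)) z :=
  AnalyticAt.fun_comp (g := F) (f := fun s => (u s, v s)) hF (hu.prod hv)

theorem exists_radius_analyticAt {F : ℂ × ℂ → ℂ} (hF : AnalyticAt ℂ F 0) :
    ∃ r > 0, ∀ x ∈ closedBall (0 : ℂ) r, ∀ y ∈ closedBall (0 : ℂ) r, AnalyticAt ℂ F (x, y) := by
  obtain ⟨r, hr, h⟩ := hF.exists_ball_analyticOnNhd
  refine ⟨r / 2, by positivity, fun x hx y hy => h _ ?_⟩
  rw [mem_ball, dist_zero_right, Prod.norm_def]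
  simp at hx hy ⊢
  constructor <;> linarith

/-- The average of an analytic germ over the rotations of order `n` in the first variable. -/
theorem AnalyticAt.exists_average {n : ℕ} (hn : n ≠ 0) {q : ℂ × ℂ → ℂ} (hq : AnalyticAt ℂ q 0) :
    ∃ Q : ℂ × ℂ → ℂ, AnalyticAt ℂ Q 0 ∧ ∀ᶠ p : ℂ × ℂ in 𝓝 0,
      n * Q (p.1 ^ n, p.2) = ∑ ζ ∈ Polynomial.nthRootsFinset n (1 : ℂ), q (ζ * p.1, p.2) := by
  obtain ⟨r, hr, h⟩ := exists_radius_analyticAt hq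
  obtain ⟨Q, hQ, hQe⟩ := exists_analyticAt_average hn hr (q := q)
    (fun p hp => (h p.1 (sphere_subset_closedBall hp.1) p.2
      (sphere_subset_closedBall hp.2)).continuousAt.continuousWithinAt)
    (fun τ hτ => DifferentiableOn.diffContOnCl_ball (U := closedBall 0 r) (fun w hw =>
      (analyticAt_comp_prodMk (h τ (sphere_subset_closedBall hτ) w hw) analyticAt_const
        analyticAt_id).differentiableAt.differentiableWithinAt) subset_rfl)
    (fun y hy => DifferentiableOn.diffContOnCl_ball (U := closedBall 0 r) (fun w hw =>
      (analyticAt_comp_prodMk (h w hw y (ball_subset_closedBall hy)) analyticAt_id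
        analyticAt_const).differentiableAt.differentiableWithinAt) subset_rfl)
  refine ⟨Q, hQ, ?_⟩
  filter_upwards [ball_mem_nhds (0 : ℂ × ℂ) hr] with p hp
  rw [mem_ball, dist_zero_right, Prod.norm_def, max_lt_iff] at hp
  exact hQe _ (by simpa using hp.1) _ (by simpa using hp.2)

/-- Division of an analytic germ by the second variable. -/
theorem AnalyticAt.exists_div_snd {F : ℂ × ℂ → ℂ} (hF : AnalyticAt ℂ F 0) :
    ∃ G : ℂ × ℂ → ℂ, AnalyticAt ℂ G 0 ∧
      ∀ᶠ p : ℂ × ℂ in 𝓝 0, F p = F (p.1, 0) + p.2 * G p := by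
  obtain ⟨r, hr, h⟩ := exists_radius_analyticAt hF
  have h0 : (0 : ℂ) ∈ closedBall (0 : ℂ) r := by simpa using hr.le
  have hslice : ∀ x ∈ closedBall (0 : ℂ) r,
      DifferentiableOn ℂ (fun w => F (x, w)) (closedBall 0 r) := fun x hx w hw =>
    (analyticAt_comp_prodMk (h x hx w hw) analyticAt_const
        analyticAt_id).differentiableAt.differentiableWithinAt
  have hslice' : ∀ y ∈ closedBall (0 : ℂ) r,
      DifferentiableOn ℂ (fun τ => F (τ, y)) (closedBall 0 r) := fun y hy τ hτ =>
    (analyticAt_comp_prodMk (h τ hτ y hy) analyticAt_id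
        analyticAt_const).differentiableAt.differentiableWithinAt
  have hdiv := exists_analyticAt_average one_ne_zero hr
    (q := fun p => dslope (fun w => F (p.1, w)) 0 p.2) ?_ ?_ ?_
  · obtain ⟨G, hG, hGe⟩ := hdiv
    refine ⟨G, hG, ?_⟩
    filter_upwards [ball_mem_nhds (0 : ℂ × ℂ) hr] with p hp
    rw [mem_ball, dist_zero_right, Prod.norm_def, max_lt_iff] at hp
    have := hGe p.1 (by simpa using hp.1) p.2 (by simpa using hp.2)
    simp [show Polynomial.nthRootsFinset 1 (1 : ℂ) = {1} by ext; simp] at this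
    rw [this]
    have h2 := sub_smul_dslope (fun w => F (p.1, w)) 0 p.2
    simp at h2
    rw [h2]; ring
  · have : ContinuousOn (fun p : ℂ × ℂ => p.2⁻¹ * (F p - F (p.1, 0)))
        (sphere 0 r ×ˢ sphere 0 r) := by
      refine ContinuousOn.mul (continuousOn_snd.inv₀ fun p hp => ?_) (ContinuousOn.sub ?_ ?_)
      · exact ne_of_mem_sphere hp.2 hr.ne'
      · exact fun p hp => (h p.1 (sphere_subset_closedBall hp.1) p.2
          (sphere_subset_closedBall hp.2)).continuousAt.continuousWithinAt
      · exact (hslice' 0 h0).continuousOn.comp continuousOn_fst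
          fun p hp => sphere_subset_closedBall hp.1
    refine this.congr fun p hp => ?_
    simp only
    rw [dslope_of_ne _ (ne_of_mem_sphere hp.2 hr.ne'), slope_def_field]
    simp [div_eq_inv_mul]
  · intro τ hτ
    refine DifferentiableOn.diffContOnCl_ball (U := closedBall 0 r) ?_ subset_rfl
    exact (Complex.differentiableOn_dslope (closedBall_mem_nhds _ hr)).mpr
      (hslice τ (sphere_subset_closedBall hτ))
  · intro y hy
    refine DifferentiableOn.diffContOnCl_ball (U := closedBall 0 r) ?_ subset_rfl
    rcases eq_or_ne y 0 with rfl | hy0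
    · simp only [dslope_same]
      have : ∀ x ∈ closedBall (0 : ℂ) r,
          deriv (fun w => F (x, w)) 0 = fderiv ℂ F (x, 0) (0, 1) := by
        intro x hx
        have h1 := (h x hx 0 h0).differentiableAt.hasFDerivAt.comp_hasDerivAt (0 : ℂ)
          ((hasDerivAt_const (0 : ℂ) x).prodMk (hasDerivAt_id (0 : ℂ)))
        exact h1.deriv
      refine DifferentiableOn.congr (fun x hx => ?_) this
      have h1 := (h x hx 0 h0).fderiv
      have h2 : AnalyticAt ℂ (fun s : ℂ => fderiv ℂ F (s, 0)) x :=
        AnalyticAt.fun_comp (g := fderiv ℂ F) (f := fun s : ℂ => (s, (0 : ℂ))) h1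
          (analyticAt_id.prod analyticAt_const)
      exact (h2.differentiableAt.clm_apply (differentiableAt_const _)).differentiableWithinAt
    · have : ∀ x, dslope (fun w => F (x, w)) 0 y = y⁻¹ * (F (x, y) - F (x, 0)) := by
        intro x
        rw [dslope_of_ne _ hy0, slope_def_field]
        simp [div_eq_inv_mul]
      simp only [this]
      exact ((hslice' y (ball_subset_closedBall hy)).sub (hslice' 0 h0)).const_mul _

theorem eventually_comp_prodMk {X : Type*} [TopologicalSpace X] {P : ℂ × ℂ → Prop}
    (h : ∀ᶠ p in 𝓝 (0 : ℂ × ℂ), P p) {u v : X → ℂ} {z : X} (hu : ContinuousAt u z)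
    (hv : ContinuousAt v z) (hu0 : u z = 0) (hv0 : v z = 0) : ∀ᶠ t in 𝓝 z, P (u t, v t) := by
  have : ContinuousAt (fun t => (u t, v t)) z := hu.prodMk hv
  refine this.eventually ?_
  simp only [hu0, hv0]
  exact h

theorem analyticAt_comp_prodMk_zero {E : Type*} [NormedAddCommGroup E] [NormedSpace ℂ E]
    {F : ℂ × ℂ → ℂ} {u v : E → ℂ} {z : E}
    (hF : AnalyticAt ℂ F 0) (hu : AnalyticAt ℂ u z) (hv : AnalyticAt ℂ v z)
    (hu0 : u z = 0) (hv0 : v z = 0) :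
    AnalyticAt ℂ (fun s => F (u s, v s)) z :=
  AnalyticAt.fun_comp (g := F) (f := fun s => (u s, v s))
    (by rw [hu0, hv0]; exact hF) (hu.prod hv)

theorem AnalyticAt.eventually_eq_zero_of_punctured {F : ℂ → ℂ} {z : ℂ} (hF : AnalyticAt ℂ F z)
    (h : ∀ᶠ t in 𝓝[≠] z, F t = 0) : ∀ᶠ t in 𝓝 z, F t = 0 :=
  hF.frequently_zero_iff_eventually_zero.mp h.frequently

theorem eventually_of_eventually_pow {n : ℕ} (hn : n ≠ 0) {P : ℂ × ℂ → Prop}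
    (h : ∀ᶠ p in 𝓝 (0 : ℂ × ℂ), P (p.1 ^ n, p.2)) : ∀ᶠ p in 𝓝 (0 : ℂ × ℂ), P p := by
  obtain ⟨ε, hε, hP⟩ := Metric.eventually_nhds_iff.mp h
  have h1 : ∀ᶠ p : ℂ × ℂ in 𝓝 0, ‖p.1‖ < ε ^ n :=
    (continuous_fst.norm).continuousAt.eventually_lt_const (by simpa using pow_pos hε n)
  have h2 : ∀ᶠ p : ℂ × ℂ in 𝓝 0, ‖p.2‖ < ε :=
    (continuous_snd.norm).continuousAt.eventually_lt_const (by simpa using hε)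
  filter_upwards [h1, h2] with p hp1 hp2
  obtain ⟨t, ht⟩ := IsAlgClosed.exists_pow_nat_eq p.1 (Nat.pos_of_ne_zero hn)
  have htε : ‖t‖ < ε := by
    rw [← ht, norm_pow] at hp1
    exact lt_of_pow_lt_pow_left₀ n hε.le hp1
  have := @hP (t, p.2) (by
    rw [dist_zero_right, Prod.norm_def]
    exact max_lt htε hp2)
  simpa [ht] using this

theorem eventually_of_eventually_pow_one {n : ℕ} (hn : n ≠ 0) {P : ℂ → Prop}
    (h : ∀ᶠ t in 𝓝 (0 : ℂ), P (t ^ n)) : ∀ᶠ x in 𝓝 (0 : ℂ), P x := by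
  have h1 : ∀ᶠ p in 𝓝 (0 : ℂ × ℂ), P p.1 := eventually_of_eventually_pow hn
    ((continuous_fst.tendsto' (0 : ℂ × ℂ) 0 rfl).eventually h)
  exact eventually_comp_prodMk h1 continuousAt_id continuousAt_const rfl (v := fun _ => 0) rfl

/-- The curve `t ↦ (t ^ n, φ t)` is an integral curve of the vector field `x A ∂x + B ∂y`. -/
structure PuiseuxSolution (A B : ℂ × ℂ → ℂ) (n : ℕ) (φ : ℂ → ℂ) : Prop where
  ne_zero : n ≠ 0
  analyticAt : AnalyticAt ℂ φ 0
  map_zero : φ 0 = 0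
  eventually_eq : ∀ᶠ t in 𝓝 (0 : ℂ),
    A (t ^ n, φ t) * (t * deriv φ t) = n * B (t ^ n, φ t)

/-- A germ invariant under a rotation of order `d` is a germ in the `d`-th power. -/
theorem AnalyticAt.exists_eq_comp_pow {φ : ℂ → ℂ} (hφ : AnalyticAt ℂ φ 0) {d : ℕ} (hd : d ≠ 0)
    (h : ∀ ζ : ℂ, ζ ^ d = 1 → ∀ᶠ t in 𝓝 (0 : ℂ), φ (ζ * t) = φ t) :
    ∃ ψ : ℂ → ℂ, AnalyticAt ℂ ψ 0 ∧ ∀ᶠ t in 𝓝 (0 : ℂ), φ t = ψ (t ^ d) := by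
  obtain ⟨Q, hQ, hQe⟩ := AnalyticAt.exists_average hd (q := fun p => φ p.1)
    (AnalyticAt.fun_comp (g := φ) (f := Prod.fst) hφ analyticAt_fst)
  refine ⟨fun x => Q (x, 0), analyticAt_comp_prodMk_zero hQ analyticAt_id analyticAt_const rfl rfl,
    ?_⟩
  have h1 : ∀ᶠ t in 𝓝 (0 : ℂ), ∀ ζ ∈ Polynomial.nthRootsFinset d (1 : ℂ), φ (ζ * t) = φ t := by
    rw [eventually_all_finset]
    exact fun ζ hζ => h ζ ((Polynomial.mem_nthRootsFinset (Nat.pos_of_ne_zero hd) _).mp hζ)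
  have h2 := eventually_comp_prodMk hQe (u := fun t : ℂ => t) (v := fun _ => 0)
    continuousAt_id continuousAt_const rfl rfl
  filter_upwards [h1, h2] with t ht1 ht2
  rw [Finset.sum_congr rfl ht1, Finset.sum_const,
    (Complex.isPrimitiveRoot_exp d hd).card_nthRootsFinset, nsmul_eq_mul] at ht2
  exact (mul_left_cancel₀ (by exact_mod_cast hd) ht2).symm

/-- The conjugates of a solution with minimal ramification are pairwise distinct. -/
theorem PuiseuxSolution.conj_ne {A B : ℂ × ℂ → ℂ} {n : ℕ} {φ : ℂ → ℂ}
    (h : PuiseuxSolution A B n φ) (hmin : ∀ m ψ, PuiseuxSolution A B m ψ → n ≤ m)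
    {ζ ξ : ℂ} (hζ : ζ ^ n = 1) (hξ : ξ ^ n = 1) (hne : ζ ≠ ξ) :
    ¬ ∀ᶠ t in 𝓝 (0 : ℂ), φ (ζ * t) = φ (ξ * t) := by
  intro heq
  have hn := h.ne_zero
  have hζ0 : ζ ≠ 0 := by rintro rfl; simp [hn] at hζ
  set η := ξ / ζ with hη
  have hη1 : η ≠ 1 := fun h1 => hne ((div_eq_one_iff_eq hζ0).mp h1).symm
  have hηn : η ^ n = 1 := by rw [hη, div_pow, hζ, hξ, div_one]
  have hinv : ∀ᶠ t in 𝓝 (0 : ℂ), φ (η * t) = φ t := by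
    have ht : Tendsto (fun t : ℂ => ζ⁻¹ * t) (𝓝 0) (𝓝 0) :=
      Continuous.tendsto' (by fun_prop) _ _ (by simp)
    filter_upwards [ht.eventually heq] with t h1
    rw [mul_inv_cancel_left₀ hζ0] at h1
    rw [h1, hη]; congr 1; ring
  set d := orderOf η with hd
  have hdn : d ∣ n := orderOf_dvd_of_pow_eq_one hηn
  have hd0 : d ≠ 0 := fun h0 => hn (Nat.eq_zero_of_zero_dvd (h0 ▸ hdn))
  have hd1 : d ≠ 1 := fun h1 => hη1 (orderOf_eq_one_iff.mp h1)
  have hinvk : ∀ k : ℕ, ∀ᶠ t in 𝓝 (0 : ℂ), φ (η ^ k * t) = φ t := by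
    intro k
    induction k with
    | zero => simp
    | succ k ih =>
      have ht : Tendsto (fun t : ℂ => η ^ k * t) (𝓝 0) (𝓝 0) :=
        Continuous.tendsto' (by fun_prop) _ _ (by simp)
      filter_upwards [ht.eventually hinv, ih] with t h1 h2
      rw [← h2, ← h1, pow_succ']; congr 1; ring
  obtain ⟨ψ, hψ, hψe⟩ := h.analyticAt.exists_eq_comp_pow hd0 fun ξ hξ => by
    have : NeZero d := ⟨hd0⟩
    obtain ⟨k, -, rfl⟩ := (IsPrimitiveRoot.orderOf η).eq_pow_of_pow_eq_one hξ
    exact hinvk k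
  obtain ⟨m, hm⟩ := hdn
  have hm0 : m ≠ 0 := by rintro rfl; simp at hm; exact hn hm
  have hsol : PuiseuxSolution A B m ψ := by
    refine ⟨hm0, hψ, ?_, eventually_of_eventually_pow_one hd0 ?_⟩
    · have := hψe.self_of_nhds
      rw [h.map_zero, zero_pow hd0] at this
      exact this.symm
    · have htend : Tendsto (fun t : ℂ => t ^ d) (𝓝 0) (𝓝 0) :=
        Continuous.tendsto' (by fun_prop) _ _ (by simp [hd0])
      filter_upwards [h.eventually_eq, hψe.eventually_nhds,
        htend.eventually hψ.eventually_analyticAt] with t h1 h2 h3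
      have hder : deriv φ t = deriv ψ (t ^ d) * (d * t ^ (d - 1)) := by
        rw [EventuallyEq.deriv_eq h2]
        exact (h3.differentiableAt.hasDerivAt.comp t (hasDerivAt_pow d t)).deriv
      rw [Eventually.self_of_nhds h2, hder, hm, pow_mul] at h1
      have hdt : t * t ^ (d - 1) = t ^ d := by
        rw [← pow_succ', Nat.sub_add_cancel (Nat.pos_of_ne_zero hd0)]
      have hdC : (d : ℂ) ≠ 0 := by exact_mod_cast hd0
      apply mul_left_cancel₀ hdC
      rw [← hdt] at h1 ⊢
      push_cast at h1
      linear_combination h1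
  have h3 := hmin m ψ hsol
  have : 2 ≤ d := by omega
  have : 2 * m ≤ d * m := Nat.mul_le_mul_right m this
  omega

/-- An analytic germ vanishing on pairwise distinct graphs is divisible by the product of their
equations. -/
theorem exists_eq_prod_mul {ι : Type*} (s : Finset ι) {ψ : ι → ℂ → ℂ}
    (hψ : ∀ i ∈ s, AnalyticAt ℂ (ψ i) 0) (hψ0 : ∀ i ∈ s, ψ i 0 = 0)
    (hne : ∀ i ∈ s, ∀ k ∈ s, i ≠ k → ¬ ∀ᶠ t in 𝓝 (0 : ℂ), ψ i t = ψ k t)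
    {F : ℂ × ℂ → ℂ} (hF : AnalyticAt ℂ F 0)
    (hv : ∀ i ∈ s, ∀ᶠ t in 𝓝 (0 : ℂ), F (t, ψ i t) = 0) :
    ∃ q : ℂ × ℂ → ℂ, AnalyticAt ℂ q 0 ∧
      ∀ᶠ p : ℂ × ℂ in 𝓝 0, F p = (∏ i ∈ s, (p.2 - ψ i p.1)) * q p := by
  classical
  induction s using Finset.induction_on with
  | empty => exact ⟨F, hF, by simp⟩
  | insert i s his ih =>
    simp only [Finset.mem_insert, forall_eq_or_imp] at hψ hψ0 hv
    obtain ⟨q, hq, hqe⟩ := ih hψ.2 hψ0.2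
      (fun k hk l hl => hne k (Finset.mem_insert_of_mem hk) l (Finset.mem_insert_of_mem hl)) hv.2
    have hfac : ∀ᶠ t in 𝓝[≠] (0 : ℂ), ∀ k ∈ s, ψ i t - ψ k t ≠ 0 := by
      rw [eventually_all_finset]
      intro k hk
      refine ((hψ.1.sub (hψ.2 k hk)).eventually_eq_zero_or_eventually_ne_zero).resolve_left ?_
      intro h0
      refine hne i (Finset.mem_insert_self _ _) k (Finset.mem_insert_of_mem hk)
        (fun h => his (h ▸ hk)) ?_
      filter_upwards [h0] with t ht
      exact sub_eq_zero.mp ht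
    have hqv : ∀ᶠ t in 𝓝 (0 : ℂ), q (t, ψ i t) = 0 := by
      refine (analyticAt_comp_prodMk_zero hq analyticAt_id hψ.1 rfl
        hψ0.1).eventually_eq_zero_of_punctured ?_
      have h1 := eventually_comp_prodMk hqe (u := fun t : ℂ => t) (v := ψ i) continuousAt_id
        hψ.1.continuousAt rfl hψ0.1
      filter_upwards [hfac, h1.filter_mono nhdsWithin_le_nhds,
        hv.1.filter_mono nhdsWithin_le_nhds] with t h2 h3 h4
      rw [h4] at h3
      exact (mul_eq_zero.mp h3.symm).resolve_left (Finset.prod_ne_zero_iff.mpr h2)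
    have hfst : AnalyticAt ℂ (fun p : ℂ × ℂ => ψ i p.1) 0 :=
      AnalyticAt.fun_comp (g := ψ i) (f := Prod.fst) hψ.1 analyticAt_fst
    obtain ⟨G, hG, hGe⟩ := AnalyticAt.exists_div_snd (F := fun p => q (p.1, ψ i p.1 + p.2))
      (analyticAt_comp_prodMk_zero hq analyticAt_fst (hfst.add analyticAt_snd) rfl
        (by simp [hψ0.1]))
    refine ⟨fun p => G (p.1, p.2 - ψ i p.1),
      analyticAt_comp_prodMk_zero hG analyticAt_fst (analyticAt_snd.sub hfst) rfl
        (by simp [hψ0.1]), ?_⟩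
    have h1 := eventually_comp_prodMk hGe (u := fun p : ℂ × ℂ => p.1)
      (v := fun p => p.2 - ψ i p.1) continuousAt_fst (analyticAt_snd.sub hfst).continuousAt rfl
        (by simp [hψ0.1])
    have h2 := (continuous_fst.tendsto' (0 : ℂ × ℂ) 0 rfl).eventually hqv
    filter_upwards [hqe, h1, h2] with p hp1 hp2 hp3
    rw [Finset.prod_insert his, hp1]
    simp only [add_zero, hp3, add_sub_cancel, zero_add, Prod.mk.eta] at hp2
    rw [hp2]; ring

theorem fderiv_apply_prod (f : ℂ × ℂ → ℂ) (p : ℂ × ℂ) (u v : ℂ) :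
    fderiv ℂ f p (u, v) = u * fderiv ℂ f p (1, 0) + v * fderiv ℂ f p (0, 1) := by
  have : ((u, v) : ℂ × ℂ) = u • ((1 : ℂ), (0 : ℂ)) + v • ((0 : ℂ), (1 : ℂ)) := by simp
  rw [this, map_add, map_smul, map_smul, smul_eq_mul, smul_eq_mul]

/-- The minimal equation of a curve `t ↦ (t ^ n, φ t)` with distinct conjugates. -/
theorem exists_minimal_equation {n : ℕ} (hn : n ≠ 0) {φ : ℂ → ℂ} (hφ : AnalyticAt ℂ φ 0)
    (hφ0 : φ 0 = 0) (hconj : ∀ ζ ξ : ℂ, ζ ^ n = 1 → ξ ^ n = 1 → ζ ≠ ξ →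
      ¬ ∀ᶠ t in 𝓝 (0 : ℂ), φ (ζ * t) = φ (ξ * t)) :
    ∃ f : ℂ × ℂ → ℂ, AnalyticAt ℂ f 0 ∧ (∀ᶠ y in 𝓝 (0 : ℂ), f (0, y) = y ^ n) ∧
      (∀ᶠ t in 𝓝 (0 : ℂ), f (t ^ n, φ t) = 0) ∧
      ∀ F : ℂ × ℂ → ℂ, AnalyticAt ℂ F 0 → (∀ᶠ t in 𝓝 (0 : ℂ), F (t ^ n, φ t) = 0) →
        ∃ Q : ℂ × ℂ → ℂ, AnalyticAt ℂ Q 0 ∧ ∀ᶠ p : ℂ × ℂ in 𝓝 0, F p = f p * Q p := by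
  classical
  set μ := Polynomial.nthRootsFinset n (1 : ℂ) with hμ
  have hmem : ∀ ζ, ζ ∈ μ ↔ ζ ^ n = 1 := fun ζ =>
    Polynomial.mem_nthRootsFinset (Nat.pos_of_ne_zero hn) _
  have hcard : μ.card = n := (Complex.isPrimitiveRoot_exp n hn).card_nthRootsFinset
  have hnC : (n : ℂ) ≠ 0 := by exact_mod_cast hn
  have hcφ : ∀ ζ : ℂ, AnalyticAt ℂ (fun t => φ (ζ * t)) 0 := fun ζ =>
    AnalyticAt.fun_comp (g := φ) (f := fun t => ζ * t) (by simpa using hφ) (by fun_prop)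
  set g : ℂ × ℂ → ℂ := fun p => ∏ ζ ∈ μ, (p.2 - φ (ζ * p.1)) with hg
  have hga : AnalyticAt ℂ g 0 := by
    refine Finset.analyticAt_fun_prod _ fun ζ _ => analyticAt_snd.sub ?_
    exact AnalyticAt.fun_comp (g := fun t => φ (ζ * t)) (f := Prod.fst) (hcφ ζ) analyticAt_fst
  have hginv : ∀ ξ ∈ μ, ∀ p : ℂ × ℂ, g (ξ * p.1, p.2) = g p := by
    intro ξ hξ p
    have hξ0 : ξ ≠ 0 := by
      rintro rfl
      simp [hmem, hn] at hξ
    simp only [hg]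
    refine Finset.prod_bij (fun ζ _ => ζ * ξ) ?_ ?_ ?_ ?_
    · intro ζ hζ
      rw [hmem] at *
      rw [mul_pow, hζ, hξ, one_mul]
    · intro ζ _ ζ' _ h
      exact mul_right_cancel₀ hξ0 h
    · intro ζ hζ
      refine ⟨ζ / ξ, ?_, div_mul_cancel₀ _ hξ0⟩
      rw [hmem] at *
      rw [div_pow, hζ, hξ, one_div_one]
    · intro ζ _
      rw [mul_assoc]
  obtain ⟨f, hf, hfe⟩ := hga.exists_average hn
  have hfg : ∀ᶠ p : ℂ × ℂ in 𝓝 0, f (p.1 ^ n, p.2) = g p := by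
    filter_upwards [hfe] with p hp
    rw [Finset.sum_congr rfl (fun ζ hζ => hginv ζ hζ p), Finset.sum_const, nsmul_eq_mul,
      hcard] at hp
    exact mul_left_cancel₀ hnC hp
  refine ⟨f, hf, ?_, ?_, ?_⟩
  · filter_upwards [eventually_comp_prodMk hfg (u := fun _ : ℂ => 0) (v := fun y => y)
      continuousAt_const continuousAt_id rfl rfl] with y hy
    simpa [hn, hg, hφ0, hcard] using hy
  · filter_upwards [eventually_comp_prodMk hfg (u := fun t : ℂ => t) (v := φ)
      continuousAt_id hφ.continuousAt rfl hφ0] with t ht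
    rw [ht]
    exact Finset.prod_eq_zero ((hmem 1).mpr (one_pow n)) (by simp)
  · intro F hF hFv
    have hFn : AnalyticAt ℂ (fun p : ℂ × ℂ => F (p.1 ^ n, p.2)) 0 :=
      analyticAt_comp_prodMk_zero hF (by fun_prop) analyticAt_snd (by simp [hn]) rfl
    obtain ⟨q, hq, hqe⟩ := exists_eq_prod_mul μ (ψ := fun ζ t => φ (ζ * t)) (fun ζ _ => hcφ ζ)
      (fun ζ _ => by simp [hφ0])
      (fun ζ hζ ξ hξ => hconj ζ ξ ((hmem _).mp hζ) ((hmem _).mp hξ)) hFn (by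
        intro ζ hζ
        have ht : Tendsto (fun t : ℂ => ζ * t) (𝓝 0) (𝓝 0) :=
          Continuous.tendsto' (by fun_prop) _ _ (by simp)
        filter_upwards [ht.eventually hFv] with t h1
        simpa [mul_pow, (hmem ζ).mp hζ] using h1)
    obtain ⟨Q, hQ, hQe⟩ := hq.exists_average hn
    refine ⟨Q, hQ, eventually_of_eventually_pow hn ?_⟩
    have hall : ∀ᶠ p : ℂ × ℂ in 𝓝 0, ∀ ζ ∈ μ, F (p.1 ^ n, p.2) = g p * q (ζ * p.1, p.2) := by
      rw [eventually_all_finset]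
      intro ζ hζ
      filter_upwards [eventually_comp_prodMk hqe (u := fun p : ℂ × ℂ => ζ * p.1)
        (v := fun p => p.2) (by fun_prop) (by fun_prop) (by simp) rfl] with p hp
      have h2 := hginv ζ hζ p
      simp only [hg] at h2 ⊢
      rw [← h2, ← hp]
      simp [mul_pow, (hmem ζ).mp hζ]
    filter_upwards [hall, hQe, hfg] with p h1 h2 h3
    rw [h3]
    apply mul_left_cancel₀ hnC
    have h4 := Finset.sum_congr rfl h1
    rw [Finset.sum_const, nsmul_eq_mul, hcard, ← Finset.mul_sum, ← h2] at h4
    rw [h4]; ring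

theorem separatrix_of_puiseuxSolution {a b : ℂ × ℂ → ℂ} (ha : AnalyticAt ℂ a 0)
    (hb : AnalyticAt ℂ b 0)
    (h : ∃ n φ, PuiseuxSolution (fun p => -b p) (fun p => p.1 * a p) n φ) :
    ∃ f, Separatrix a b f := by
  classical
  obtain ⟨φ, hsol⟩ := Nat.find_spec h
  set n := Nat.find h with hnfind
  have hn := hsol.ne_zero
  have hφ := hsol.analyticAt
  have hφ0 := hsol.map_zero
  obtain ⟨f, hf, hfy, hfφ, hdiv⟩ := exists_minimal_equation hn hφ hφ0
    (fun ζ ξ hζ hξ hne => hsol.conj_ne (fun m ψ hm => Nat.find_min' h ⟨ψ, hm⟩) hζ hξ hne)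
  have hpow : ∀ {F : ℂ × ℂ → ℂ}, AnalyticAt ℂ F 0 → AnalyticAt ℂ (fun t => F (t ^ n, φ t)) 0 :=
    fun hF => analyticAt_comp_prodMk_zero hF (by fun_prop) hφ (by simp [hn]) hφ0
  have hnC : (n : ℂ) ≠ 0 := by exact_mod_cast hn
  refine ⟨f, ⟨hf, ?_, ?_, ?_⟩, ?_⟩
  · have := hfy.self_of_nhds
    rw [zero_pow hn] at this
    exact this
  · intro h0
    have h1 := eventually_comp_prodMk h0 (u := fun _ : ℂ => 0) (v := fun y => y)
      continuousAt_const continuousAt_id rfl rfl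
    have h2 : ∀ᶠ y in 𝓝[≠] (0 : ℂ), y ≠ 0 := eventually_mem_nhdsWithin
    obtain ⟨y, hy1, hy2, hy3⟩ := (h2.and ((h1.and hfy).filter_mono nhdsWithin_le_nhds)).exists
    exact pow_ne_zero n hy1 (hy3.symm.trans hy2)
  · have key : ∀ g k : ℂ × ℂ → ℂ, AnalyticAt ℂ g 0 → AnalyticAt ℂ k 0 → k 0 = 0 →
        (∀ᶠ q in 𝓝 (0 : ℂ × ℂ), f q = g q * k q) →
        ¬ ∀ᶠ t in 𝓝 (0 : ℂ), g (t ^ n, φ t) = 0 := by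
      intro g k hg hk hk0 hfac hgv
      obtain ⟨Q, hQ, hQe⟩ := hdiv g hg hgv
      have h1 := eventually_comp_prodMk (hfac.and hQe) (u := fun _ : ℂ => 0) (v := fun y => y)
        continuousAt_const continuousAt_id rfl rfl
      have hone : ∀ᶠ y in 𝓝[≠] (0 : ℂ), Q (0, y) * k (0, y) = 1 := by
        filter_upwards [(h1.and hfy).filter_mono nhdsWithin_le_nhds,
          eventually_mem_nhdsWithin] with y hy hy0
        obtain ⟨⟨e1, e2⟩, e3⟩ := hy
        rw [e2, e3] at e1
        apply mul_left_cancel₀ (pow_ne_zero n (show y ≠ 0 from hy0))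
        rw [mul_one, ← mul_assoc]
        exact e1.symm
      have hcont : ContinuousAt (fun y : ℂ => Q (0, y) * k (0, y)) 0 :=
        ((analyticAt_comp_prodMk_zero hQ analyticAt_const analyticAt_id rfl rfl).mul
          (analyticAt_comp_prodMk_zero hk analyticAt_const analyticAt_id rfl rfl)).continuousAt
      have hlim := hcont.tendsto.mono_left (nhdsWithin_le_nhds (s := {0}ᶜ))
      have := tendsto_nhds_unique (hlim.congr' hone) tendsto_const_nhds
      rw [show ((0 : ℂ), (0 : ℂ)) = 0 from rfl, hk0, mul_zero] at this
      exact zero_ne_one this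
    rintro ⟨g, k, hg, hk, hg0, hk0, hfac⟩
    have h1 := eventually_comp_prodMk hfac (u := fun t : ℂ => t ^ n) (v := φ)
      (by fun_prop) hφ.continuousAt (by simp [hn]) hφ0
    rcases (hpow hg).eventually_eq_zero_or_eventually_ne_zero with h2 | h2
    · exact key g k hg hk hk0 hfac h2
    · refine key k g hk hg hg0 (by simpa only [mul_comm] using hfac)
        ((hpow hk).eventually_eq_zero_of_punctured ?_)
      filter_upwards [h2, (h1.and hfφ).filter_mono nhdsWithin_le_nhds] with t h3 h4
      exact (mul_eq_zero.mp (h4.1.symm.trans h4.2)).resolve_left h3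
  · have hfx : AnalyticAt ℂ (fun p => fderiv ℂ f p (1, 0)) 0 :=
      AnalyticAt.fun_comp (g := fun L : ℂ × ℂ →L[ℂ] ℂ => L (1, 0))
        ((ContinuousLinearMap.apply ℂ ℂ ((1 : ℂ), (0 : ℂ))).analyticAt _) hf.fderiv
    have hfy' : AnalyticAt ℂ (fun p => fderiv ℂ f p (0, 1)) 0 :=
      AnalyticAt.fun_comp (g := fun L : ℂ × ℂ →L[ℂ] ℂ => L (0, 1))
        ((ContinuousLinearMap.apply ℂ ℂ ((0 : ℂ), (1 : ℂ))).analyticAt _) hf.fderiv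
    have hW := (ha.mul hfy').sub (hb.mul hfx)
    refine hdiv _ hW ((hpow hW).eventually_eq_zero_of_punctured ?_)
    have han := eventually_comp_prodMk hf.eventually_analyticAt (u := fun t : ℂ => t ^ n) (v := φ)
      (by fun_prop) hφ.continuousAt (by simp [hn]) hφ0
    filter_upwards [eventually_mem_nhdsWithin, (((hfφ.eventually_nhds.and han).and
      hφ.eventually_analyticAt).and hsol.eventually_eq).filter_mono nhdsWithin_le_nhds]
      with t ht0 ht
    obtain ⟨⟨⟨h1, h2⟩, h3⟩, h4⟩ := ht
    have ht0' : t ≠ 0 := ht0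
    have hd := h2.differentiableAt.hasFDerivAt.comp_hasDerivAt t
      ((hasDerivAt_pow n t).prodMk h3.differentiableAt.hasDerivAt)
    have hd0 : HasDerivAt (fun t => f (t ^ n, φ t)) 0 t :=
      (hasDerivAt_const t (0 : ℂ)).congr_of_eventuallyEq h1
    have e := hd.unique hd0
    rw [fderiv_apply_prod] at e
    have hdt : t ^ n = t * t ^ (n - 1) := by
      rw [← pow_succ', Nat.sub_add_cancel (Nat.pos_of_ne_zero hn)]
    apply mul_left_cancel₀ (mul_ne_zero hnC (pow_ne_zero n ht0'))
    simp only [Pi.sub_apply, Pi.mul_apply, mul_zero]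
    simp only [hdt] at h4 e ⊢
    linear_combination (-fderiv ℂ f (t * t ^ (n - 1), φ t) (0, 1)) * h4 -
      b (t * t ^ (n - 1), φ t) * t * e

/-- If `b` vanishes on `x = 0`, this line is a separatrix. -/
theorem separatrix_fst {a b : ℂ × ℂ → ℂ} (hb : AnalyticAt ℂ b 0)
    (h : ∀ᶠ y in 𝓝 (0 : ℂ), b (0, y) = 0) : Separatrix a b Prod.fst := by
  refine ⟨⟨analyticAt_fst, rfl, ?_, ?_⟩, ?_⟩
  · intro h0
    have h1 := eventually_comp_prodMk h0 (u := fun x : ℂ => x) (v := fun _ => 0)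
      continuousAt_id continuousAt_const rfl rfl
    obtain ⟨y, hy, hy0⟩ := ((h1.filter_mono nhdsWithin_le_nhds).and
      (eventually_mem_nhdsWithin (a := (0 : ℂ)) (s := {0}ᶜ))).exists
    exact hy0 hy
  · rintro ⟨g, k, hg, hk, hg0, hk0, hfac⟩
    have h1 := (hg.differentiableAt.hasFDerivAt.mul hk.differentiableAt.hasFDerivAt)
    have h2 : HasFDerivAt (g * k) (ContinuousLinearMap.fst ℂ ℂ ℂ) 0 :=
      hasFDerivAt_fst.congr_of_eventuallyEq (by filter_upwards [hfac] with q hq; exact hq.symm)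
    have := congrArg (fun L : ℂ × ℂ →L[ℂ] ℂ => L (1, 0)) (h2.unique h1)
    simp [hg0, hk0] at this
  · obtain ⟨G, hG, hGe⟩ := AnalyticAt.exists_div_snd (F := fun p => b (p.2, p.1))
      (analyticAt_comp_prodMk_zero hb analyticAt_snd analyticAt_fst rfl rfl)
    refine ⟨fun p => -G (p.2, p.1),
      (analyticAt_comp_prodMk_zero hG analyticAt_snd analyticAt_fst rfl rfl).neg, ?_⟩
    have h1 := eventually_comp_prodMk hGe (u := fun p : ℂ × ℂ => p.2) (v := fun p => p.1)
      (z := (0 : ℂ × ℂ)) continuousAt_snd continuousAt_fst rfl rfl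
    filter_upwards [h1, (continuous_snd.tendsto' (0 : ℂ × ℂ) 0 rfl).eventually h] with p hp hp'
    simp only [fderiv_fst, ContinuousLinearMap.coe_fst', hp', zero_add, Prod.mk.eta] at hp ⊢
    rw [hp]; ring

/-- The solution operator of `x * z' + (m + 1) * z = F`. -/
noncomputable def eulerInverse (m : ℕ) (F : ℂ → ℂ) (x : ℂ) : ℂ :=
  ∫ τ in (0 : ℝ)..1, (τ : ℂ) ^ m * F (τ * x)

theorem real_mul_mem_ball {r : ℝ} {x : ℂ} (hx : x ∈ ball (0 : ℂ) r) {τ : ℝ}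
    (hτ : τ ∈ Icc (0 : ℝ) 1) : (τ : ℂ) * x ∈ ball (0 : ℂ) r := by
  rw [mem_ball_zero_iff] at hx ⊢
  rw [norm_mul, Complex.norm_real, Real.norm_of_nonneg hτ.1]
  nlinarith [norm_nonneg x, hτ.2]

theorem intervalIntegrable_eulerInverse (m : ℕ) {F : ℂ → ℂ} {r : ℝ}
    (hF : ContinuousOn F (ball 0 r)) {x : ℂ} (hx : x ∈ ball (0 : ℂ) r) :
    IntervalIntegrable (fun τ : ℝ => (τ : ℂ) ^ m * F (τ * x)) MeasureTheory.volume 0 1 := by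
  apply ContinuousOn.intervalIntegrable
  rw [uIcc_of_le zero_le_one]
  exact ContinuousOn.mul (by fun_prop)
    (hF.comp (by fun_prop) fun τ hτ => real_mul_mem_ball hx hτ)

theorem norm_eulerInverse_le (m : ℕ) {F : ℂ → ℂ} {r C : ℝ}
    (hF : ∀ x ∈ ball (0 : ℂ) r, ‖F x‖ ≤ C) {x : ℂ} (hx : x ∈ ball (0 : ℂ) r) :
    ‖eulerInverse m F x‖ ≤ C / (m + 1) := by
  have h := intervalIntegral.norm_integral_le_of_norm_le (a := (0 : ℝ)) (b := 1)
    (f := fun τ : ℝ => (τ : ℂ) ^ m * F (τ * x)) (g := fun τ => τ ^ m * C)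
    (μ := MeasureTheory.volume) zero_le_one
    (Eventually.of_forall fun τ hτ => ?_)
    (Continuous.intervalIntegrable (by fun_prop) _ _)
  · refine h.trans (le_of_eq ?_)
    rw [intervalIntegral.integral_mul_const, integral_pow]
    simp; ring
  · rw [norm_mul, norm_pow, Complex.norm_real, Real.norm_of_nonneg hτ.1.le]
    exact mul_le_mul_of_nonneg_left (hF _ (real_mul_mem_ball hx ⟨hτ.1.le, hτ.2⟩))
      (pow_nonneg hτ.1.le _)

theorem eulerInverse_sub (m : ℕ) {F G : ℂ → ℂ} {r : ℝ}
    (hF : ContinuousOn F (ball 0 r)) (hG : ContinuousOn G (ball 0 r)) {x : ℂ}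
    (hx : x ∈ ball (0 : ℂ) r) :
    eulerInverse m F x - eulerInverse m G x = eulerInverse m (fun x => F x - G x) x := by
  unfold eulerInverse
  rw [← intervalIntegral.integral_sub (intervalIntegrable_eulerInverse m hF hx)
    (intervalIntegrable_eulerInverse m hG hx)]
  simp only [mul_sub]

theorem hasDerivAt_eulerInverse (m : ℕ) {F : ℂ → ℂ} {r : ℝ}
    (hF : DifferentiableOn ℂ F (ball 0 r)) {x : ℂ} (hx : x ∈ ball (0 : ℂ) r) :
    ∃ D, HasDerivAt (eulerInverse m F) D x ∧ x * D + (m + 1) * eulerInverse m F x = F x := by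
  have hdF : DifferentiableOn ℂ (deriv F) (ball 0 r) := hF.deriv isOpen_ball
  obtain ⟨r', hxr', hr'⟩ := exists_between (mem_ball_zero_iff.mp hx)
  obtain ⟨C, hC⟩ := (isCompact_closedBall (0 : ℂ) r').exists_bound_of_continuousOn
    (hdF.continuousOn.mono (closedBall_subset_ball hr'))
  have hderiv : ∀ y ∈ ball (0 : ℂ) r, ∀ τ ∈ Icc (0 : ℝ) 1,
      HasDerivAt F (deriv F (τ * y)) (τ * y) := fun y hy τ hτ =>
    (hF.differentiableAt (isOpen_ball.mem_nhds (real_mul_mem_ball hy hτ))).hasDerivAt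
  have hC0 : 0 ≤ C := (norm_nonneg _).trans (hC 0 (by simpa using (norm_nonneg x).trans hxr'.le))
  have hint_succ := (intervalIntegrable_eulerInverse (m + 1) hdF.continuousOn hx)
  have key := intervalIntegral.hasDerivAt_integral_of_dominated_loc_of_deriv_le
    (μ := MeasureTheory.volume) (a := 0) (b := 1) (s := ball 0 r') (x₀ := x)
    (F := fun (y : ℂ) (τ : ℝ) => (τ : ℂ) ^ m * F (τ * y))
    (F' := fun (y : ℂ) (τ : ℝ) => (τ : ℂ) ^ (m + 1) * deriv F (τ * y)) (bound := fun _ => C)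
    (isOpen_ball.mem_nhds (mem_ball_zero_iff.mpr hxr'))
    ?_ (intervalIntegrable_eulerInverse m hF.continuousOn hx)
    (by rw [uIoc_of_le zero_le_one]; exact hint_succ.1.aestronglyMeasurable)
    ?_ intervalIntegrable_const ?_
  · refine ⟨_, key.2, ?_⟩
    have hval : ∀ τ ∈ uIcc (0 : ℝ) 1, HasDerivAt (fun τ : ℝ => (τ : ℂ) ^ (m + 1) * F (τ * x))
        (x * ((τ : ℂ) ^ (m + 1) * deriv F (τ * x)) + (m + 1) * ((τ : ℂ) ^ m * F (τ * x))) τ := by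
      intro τ hτ
      rw [uIcc_of_le zero_le_one] at hτ
      have h1 : HasDerivAt (fun s : ℂ => s ^ (m + 1) * F (s * x)) _ (τ : ℂ) :=
        (hasDerivAt_pow (m + 1) (τ : ℂ)).mul
          ((hderiv x hx τ hτ).comp (τ : ℂ) ((hasDerivAt_id (τ : ℂ)).mul_const x))
      convert h1.comp_ofReal using 1
      simp; ring
    have := intervalIntegral.integral_eq_sub_of_hasDerivAt hval
      ((hint_succ.const_mul x).add
        ((intervalIntegrable_eulerInverse m hF.continuousOn hx).const_mul _))
    rw [intervalIntegral.integral_add (hint_succ.const_mul x)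
      ((intervalIntegrable_eulerInverse m hF.continuousOn hx).const_mul _),
      intervalIntegral.integral_const_mul, intervalIntegral.integral_const_mul] at this
    simpa [eulerInverse] using this
  · filter_upwards [isOpen_ball.mem_nhds hx] with y hy
    rw [uIoc_of_le zero_le_one]
    exact (intervalIntegrable_eulerInverse m hF.continuousOn hy).1.aestronglyMeasurable
  · refine Eventually.of_forall fun τ hτ y hy => ?_
    rw [uIoc_of_le zero_le_one] at hτ
    rw [norm_mul, norm_pow, Complex.norm_real, Real.norm_of_nonneg hτ.1.le]
    have h1 := hC _ (ball_subset_closedBall (real_mul_mem_ball hy ⟨hτ.1.le, hτ.2⟩))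
    calc _ ≤ 1 * C := mul_le_mul (pow_le_one₀ hτ.1.le hτ.2) h1 (norm_nonneg _) zero_le_one
      _ = C := one_mul C
  · refine Eventually.of_forall fun τ hτ y hy => ?_
    rw [uIoc_of_le zero_le_one] at hτ
    have h1 := ((hderiv y (ball_subset_ball hr'.le hy) τ ⟨hτ.1.le, hτ.2⟩).comp y
      ((hasDerivAt_id y).const_mul (τ : ℂ))).const_mul ((τ : ℂ) ^ m)
    refine h1.congr_deriv ?_
    rw [pow_succ]
    ring

/-- Singular equation with a strongly stable linear part. -/
theorem exists_solution_of_norm_lt {m : ℕ} {H : ℂ × ℂ → ℂ} (hH : AnalyticAt ℂ H 0)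
    (hH0 : H 0 = 0) (hκ : ‖fderiv ℂ H 0 (0, 1)‖ < (m + 1) / 2) :
    ∃ s : ℂ → ℂ, AnalyticAt ℂ s 0 ∧ s 0 = 0 ∧
      ∀ᶠ x in 𝓝 (0 : ℂ), x * deriv s x + (m + 1) * s x = H (x, s x) := by
  obtain ⟨R, hR, hRH⟩ := exists_radius_analyticAt hH
  -- a Lipschitz constant in the second variable near the origin
  have hLip : ∃ ρ > 0, ρ ≤ R ∧ ∀ x ∈ closedBall (0 : ℂ) ρ, ∀ y ∈ closedBall (0 : ℂ) ρ,
      ∀ w ∈ closedBall (0 : ℂ) ρ, ‖H (x, y) - H (x, w)‖ ≤ (m + 1) / 2 * ‖y - w‖ := by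
    have hc : ContinuousAt (fun p => ‖fderiv ℂ H p (0, 1)‖) 0 :=
      (hH.fderiv.continuousAt.clm_apply continuousAt_const).norm
    obtain ⟨ε, hε, hεb⟩ := Metric.eventually_nhds_iff.mp (hc.eventually (gt_mem_nhds hκ))
    refine ⟨min R (ε / 2), by positivity, min_le_left _ _, fun x hx y hy w hw => ?_⟩
    refine (convex_closedBall (0 : ℂ) (min R (ε / 2))).norm_image_sub_le_of_norm_hasDerivWithin_le
      (f := fun y => H (x, y)) (f' := fun y => fderiv ℂ H (x, y) (0, 1)) (fun v hv => ?_)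
      (fun v hv => ?_) hw hy
    · have h1 := (hRH x (closedBall_subset_closedBall (min_le_left _ _) hx) v
        (closedBall_subset_closedBall (min_le_left _ _) hv)).differentiableAt.hasFDerivAt
      exact (h1.comp_hasDerivAt v ((hasDerivAt_const v x).prodMk
        (hasDerivAt_id v))).hasDerivWithinAt
    · refine (hεb ?_).le
      rw [dist_zero_right, Prod.norm_def]
      have h1 := (mem_closedBall_zero_iff.mp hx).trans (min_le_right _ _)
      have h2 := (mem_closedBall_zero_iff.mp hv).trans (min_le_right _ _)
      exact max_lt (by simp only; linarith) (by simp only; linarith)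
  obtain ⟨ρ, hρ, hρR, hLip⟩ := hLip
  obtain ⟨r, hr, hrρ, hr0⟩ : ∃ r > 0, r ≤ ρ ∧ ∀ x ∈ ball (0 : ℂ) r,
      ‖H (x, 0)‖ ≤ (m + 1) / 2 * ρ := by
    have hc : ContinuousAt (fun x => ‖H (x, 0)‖) 0 :=
      (analyticAt_comp_prodMk_zero hH analyticAt_id analyticAt_const rfl rfl).continuousAt.norm
    have h0 : ‖H (0, 0)‖ < (m + 1) / 2 * ρ := by
      rw [show ((0 : ℂ), (0 : ℂ)) = 0 from rfl, hH0, norm_zero]; positivity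
    obtain ⟨ε, hε, hεb⟩ := Metric.eventually_nhds_iff.mp (hc.eventually (gt_mem_nhds h0))
    exact ⟨min ρ ε, by positivity, min_le_left _ _, fun x hx =>
      (hεb (ball_subset_ball (min_le_right _ _) hx)).le⟩
  have hm : (0 : ℝ) < m + 1 := by positivity
  have hball : ∀ x ∈ ball (0 : ℂ) r, x ∈ closedBall (0 : ℂ) ρ := fun x hx =>
    closedBall_subset_closedBall hrρ (ball_subset_closedBall hx)
  -- admissible functions and the iteration
  let Adm : (ℂ → ℂ) → Prop := fun z => DifferentiableOn ℂ z (ball 0 r) ∧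
    ∀ x ∈ ball (0 : ℂ) r, z x ∈ closedBall (0 : ℂ) ρ
  let T : (ℂ → ℂ) → ℂ → ℂ := fun z => eulerInverse m fun x => H (x, z x)
  have hdiff : ∀ z, Adm z → DifferentiableOn ℂ (fun x => H (x, z x)) (ball 0 r) := by
    intro z hz x hx
    have h1 := (hRH x (closedBall_subset_closedBall hρR (hball x hx)) (z x)
      (closedBall_subset_closedBall hρR (hz.2 x hx))).differentiableAt
    exact (h1.comp (f := fun x => (x, z x)) x (differentiableAt_id.prodMk
      (hz.1.differentiableAt (isOpen_ball.mem_nhds hx)))).differentiableWithinAt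
  have hAdm : ∀ z, Adm z → Adm (T z) := by
    intro z hz
    refine ⟨fun x hx => ?_, fun x hx => ?_⟩
    · obtain ⟨D, hD, -⟩ := hasDerivAt_eulerInverse m (hdiff z hz) hx
      exact hD.differentiableAt.differentiableWithinAt
    · rw [mem_closedBall_zero_iff]
      refine (norm_eulerInverse_le m (C := (m + 1) * ρ) (fun y hy => ?_) hx).trans
        (le_of_eq (by field_simp))
      have h1 := hLip y (hball y hy) (z y) (hz.2 y hy) 0 (mem_closedBall_self hρ.le)
      have h2 := mem_closedBall_zero_iff.mp (hz.2 y hy)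
      have h3 := norm_sub_norm_le (H (y, z y)) (H (y, 0))
      rw [sub_zero] at h1
      have h4 : ((m : ℝ) + 1) / 2 * ‖z y‖ ≤ (m + 1) / 2 * ρ := by gcongr
      linarith [hr0 y hy]
  have hcontr : ∀ z w, Adm z → Adm w → ∀ C : ℝ, (∀ x ∈ ball (0 : ℂ) r, ‖z x - w x‖ ≤ C) →
      ∀ x ∈ ball (0 : ℂ) r, ‖T z x - T w x‖ ≤ C / 2 := by
    intro z w hz hw C hC x hx
    change ‖eulerInverse m _ x - eulerInverse m _ x‖ ≤ _
    rw [eulerInverse_sub m (hdiff z hz).continuousOn (hdiff w hw).continuousOn hx]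
    refine (norm_eulerInverse_le m (C := (m + 1) / 2 * C) (fun y hy => ?_) hx).trans
      (le_of_eq (by field_simp))
    exact (hLip y (hball y hy) _ (hz.2 y hy) _ (hw.2 y hy)).trans
      (mul_le_mul_of_nonneg_left (hC y hy) (by positivity))
  let z : ℕ → ℂ → ℂ := fun k => T^[k] fun _ => 0
  have hzs : ∀ k, z (k + 1) = T (z k) := fun k => Function.iterate_succ_apply' _ _ _
  have hz : ∀ k, Adm (z k) := by
    intro k
    induction k with
    | zero => exact ⟨differentiableOn_const _, fun x _ => mem_closedBall_self hρ.le⟩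
    | succ k ih => rw [hzs]; exact hAdm _ ih
  have hstep : ∀ k, ∀ x ∈ ball (0 : ℂ) r, ‖z (k + 1) x - z k x‖ ≤ ρ / 2 ^ k := by
    intro k
    induction k with
    | zero =>
      intro x hx
      simpa [z] using (hz 1).2 x hx
    | succ k ih =>
      intro x hx
      rw [hzs, hzs k]
      refine (hcontr _ _ (hAdm _ (hz k)) (hz k) (ρ / 2 ^ k) (fun x hx => ?_) x hx).trans
        (le_of_eq (by rw [pow_succ]; field_simp))
      rw [← hzs]; exact ih x hx
  have hdist : ∀ x ∈ ball (0 : ℂ) r, ∀ k, dist (z k x) (z (k + 1) x) ≤ 2 * ρ / 2 / 2 ^ k := by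
    intro x hx k
    rw [dist_comm, dist_eq_norm, mul_div_cancel_left₀ _ two_ne_zero]
    exact hstep k x hx
  have hlim : ∀ x ∈ ball (0 : ℂ) r, ∃ l, Tendsto (fun k => z k x) atTop (𝓝 l) := fun x hx =>
    cauchySeq_tendsto_of_complete (cauchySeq_of_le_geometric_two (hdist x hx))
  choose! s hs using hlim
  have hsz : ∀ k, ∀ x ∈ ball (0 : ℂ) r, ‖s x - z k x‖ ≤ 2 * ρ / 2 ^ k := by
    intro k x hx
    rw [← dist_eq_norm, dist_comm]
    exact dist_le_of_le_geometric_two_of_tendsto (hdist x hx) (hs x hx) k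
  have hgeo : Tendsto (fun k : ℕ => 2 * ρ / 2 ^ k) atTop (𝓝 0) := by
    have := (tendsto_pow_atTop_nhds_zero_of_lt_one (r := (1 / 2 : ℝ)) (by norm_num)
      (by norm_num)).const_mul (2 * ρ)
    simpa [div_eq_mul_inv] using this
  have hunif : TendstoUniformlyOn z s atTop (ball 0 r) := by
    rw [Metric.tendstoUniformlyOn_iff]
    intro ε hε
    filter_upwards [hgeo.eventually (gt_mem_nhds hε)] with k hk x hx
    rw [dist_eq_norm]
    exact (hsz k x hx).trans_lt hk
  have hsA : Adm s := by
    refine ⟨hunif.tendstoLocallyUniformlyOn.differentiableOn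
      (Eventually.of_forall fun k => (hz k).1) isOpen_ball, fun x hx => ?_⟩
    exact isClosed_closedBall.mem_of_tendsto (hs x hx) (Eventually.of_forall fun k => (hz k).2 x hx)
  have hTz : ∀ x ∈ ball (0 : ℂ) r, T s x = s x := by
    intro x hx
    refine tendsto_nhds_unique (f := fun k => z (k + 1) x) (l := atTop) ?_
      ((tendsto_add_atTop_iff_nat 1).mpr (hs x hx))
    rw [tendsto_iff_norm_sub_tendsto_zero]
    have hg2 : Tendsto (fun k : ℕ => 2 * ρ / 2 ^ k / 2) atTop (𝓝 0) := by
      simpa using hgeo.div_const 2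
    refine squeeze_zero (fun _ => norm_nonneg _) (fun k => ?_) hg2
    rw [hzs, norm_sub_rev]
    exact hcontr _ _ hsA (hz k) _ (hsz k) x hx
  have heq : ∀ x ∈ ball (0 : ℂ) r, x * deriv s x + (m + 1) * s x = H (x, s x) := by
    intro x hx
    obtain ⟨D, hD, hDe⟩ := hasDerivAt_eulerInverse m (hdiff s hsA) hx
    have h1 : s =ᶠ[𝓝 x] T s := by
      filter_upwards [isOpen_ball.mem_nhds hx] with y hy using (hTz y hy).symm
    rw [h1.deriv_eq, ← hTz x hx]
    change x * deriv (eulerInverse m _) x + (m + 1) * eulerInverse m _ x = H (x, T s x)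
    rw [hD.deriv, hDe, hTz x hx]
  refine ⟨s, hsA.1.analyticAt (isOpen_ball.mem_nhds (mem_ball_self hr)), ?_, ?_⟩
  · have h0 := heq 0 (mem_ball_self hr)
    have h1 := hLip 0 (mem_closedBall_self hρ.le) (s 0) (hsA.2 0 (mem_ball_self hr)) 0
      (mem_closedBall_self hρ.le)
    rw [← h0, show ((0 : ℂ), (0 : ℂ)) = 0 from rfl, hH0, sub_zero, sub_zero, zero_mul, zero_add,
      norm_mul] at h1
    have h2 : ‖((m : ℂ) + 1)‖ = m + 1 := by
      rw [show ((m : ℂ) + 1) = ((m + 1 : ℕ) : ℂ) by push_cast; rfl, Complex.norm_natCast]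
      push_cast; rfl
    rw [h2] at h1
    by_contra hne
    have := norm_pos_iff.mpr hne
    nlinarith
  · filter_upwards [isOpen_ball.mem_nhds (mem_ball_self hr)] with x hx using heq x hx

theorem AnalyticAt.fderiv_apply_const {F : ℂ × ℂ → ℂ} {p : ℂ × ℂ} (hF : AnalyticAt ℂ F p)
    (v : ℂ × ℂ) : AnalyticAt ℂ (fun q => fderiv ℂ F q v) p :=
  AnalyticAt.fun_comp (g := fun L : ℂ × ℂ →L[ℂ] ℂ => L v)
    ((ContinuousLinearMap.apply ℂ ℂ v).analyticAt _) hF.fderiv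

theorem hasDerivAt_prodMk_snd {F : ℂ × ℂ → ℂ} {x y : ℂ} (hF : AnalyticAt ℂ F (x, y)) :
    HasDerivAt (fun y => F (x, y)) (fderiv ℂ F (x, y) (0, 1)) y :=
  hF.differentiableAt.hasFDerivAt.comp_hasDerivAt y
    ((hasDerivAt_const y x).prodMk (hasDerivAt_id y))

/-- The inductive form of the Briot–Bouquet theorem: `j` counts the shifts of the exponent. -/
theorem exists_briotBouquet_of_norm_lt (j m : ℕ) : ∀ {G : ℂ × ℂ → ℂ} {κ : ℂ},
    AnalyticAt ℂ G 0 → G 0 = 0 → HasDerivAt (fun y => G (0, y)) κ 0 →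
    (∀ k : ℕ, κ ≠ k + 1) → ‖κ - j + (m + 1)‖ < (m + 1) / 2 →
    ∃ s : ℂ → ℂ, AnalyticAt ℂ s 0 ∧ s 0 = 0 ∧ ∀ᶠ x in 𝓝 (0 : ℂ), x * deriv s x = G (x, s x) := by
  induction j with
  | zero =>
    intro G κ hG hG0 hGκ _ hκ
    have hH : AnalyticAt ℂ (fun p => G p + (m + 1) * p.2) 0 := by fun_prop
    have hd : fderiv ℂ (fun p => G p + (m + 1) * p.2) 0 (0, 1) = κ + (m + 1) := by
      have h1 := hasDerivAt_prodMk_snd (x := 0) (y := 0) hH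
      have h2 := hGκ.add ((hasDerivAt_id (0 : ℂ)).const_mul ((m : ℂ) + 1))
      rw [mul_one] at h2
      exact h1.unique h2
    obtain ⟨s, hs, hs0, hse⟩ := exists_solution_of_norm_lt (m := m) hH (by simp [hG0])
      (by rw [hd]; simpa using hκ)
    refine ⟨s, hs, hs0, ?_⟩
    filter_upwards [hse] with x hx
    linear_combination hx
  | succ j ih =>
    intro G κ hG hG0 hGκ hk hκ
    obtain ⟨g₁, hg₁, hg₁e⟩ := hG.exists_div_snd
    have hGx : AnalyticAt ℂ (fun x => G (x, 0)) 0 :=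
      analyticAt_comp_prodMk_zero hG analyticAt_id analyticAt_const rfl rfl
    obtain ⟨Q, hQ, hQe⟩ := AnalyticAt.exists_div_snd (F := fun p => G (p.2, 0))
      (analyticAt_comp_prodMk_zero hG analyticAt_snd analyticAt_const rfl rfl)
    set g₀ : ℂ → ℂ := fun x => Q (0, x)
    have hg₀ : AnalyticAt ℂ g₀ 0 :=
      analyticAt_comp_prodMk_zero hQ analyticAt_const analyticAt_id rfl rfl
    have hg₀e : ∀ᶠ x in 𝓝 (0 : ℂ), G (x, 0) = x * g₀ x := by
      filter_upwards [eventually_comp_prodMk hQe (u := fun _ : ℂ => 0) (v := fun x => x)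
        continuousAt_const continuousAt_id rfl rfl] with x hx
      rw [hx, show G (0, 0) = 0 from hG0, zero_add]
    have hκ₁ : g₁ 0 = κ := by
      have h1 : (fun y => G (0, y)) =ᶠ[𝓝 0] fun y => y * g₁ (0, y) := by
        filter_upwards [eventually_comp_prodMk hg₁e (u := fun _ : ℂ => 0) (v := fun x => x)
          continuousAt_const continuousAt_id rfl rfl] with y hy
        rw [hy, show G (0, 0) = 0 from hG0, zero_add]
      have h2 : AnalyticAt ℂ (fun y => g₁ (0, y)) 0 :=
        analyticAt_comp_prodMk_zero hg₁ analyticAt_const analyticAt_id rfl rfl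
      have h3 := ((hasDerivAt_id (0 : ℂ)).mul h2.differentiableAt.hasDerivAt)
      have h4 := (hGκ.congr_of_eventuallyEq h1.symm).unique h3
      simp only [id, one_mul, zero_mul, add_zero] at h4
      exact h4.symm
    have hκ1 : 1 - κ ≠ 0 := by
      have := hk 0
      rw [Nat.cast_zero, zero_add] at this
      exact sub_ne_zero.mpr this.symm
    set c := g₀ 0 / (1 - κ) with hc
    have hcκ : c * (1 - κ) = g₀ 0 := div_mul_cancel₀ _ hκ1
    set G₁ : ℂ × ℂ → ℂ := fun p =>
      g₀ p.1 + (c + p.2) * g₁ (p.1, p.1 * (c + p.2)) - c - p.2 with hG₁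
    have hG₁a : AnalyticAt ℂ G₁ 0 := by
      have h1 : AnalyticAt ℂ (fun p : ℂ × ℂ => g₀ p.1) 0 :=
        AnalyticAt.fun_comp (g := g₀) (f := Prod.fst) hg₀ analyticAt_fst
      have h2 : AnalyticAt ℂ (fun p : ℂ × ℂ => g₁ (p.1, p.1 * (c + p.2))) 0 :=
        analyticAt_comp_prodMk_zero hg₁ analyticAt_fst (by fun_prop) rfl (by simp)
      exact ((h1.add ((analyticAt_const.add analyticAt_snd).mul h2)).sub analyticAt_const).sub
        analyticAt_snd
    have hG₁0 : ∀ z, G₁ (0, z) = (κ - 1) * z := by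
      intro z
      simp only [hG₁, zero_mul]
      rw [show g₁ (0, 0) = κ from hκ₁, ← hcκ]
      ring
    obtain ⟨s, hs, hs0, hse⟩ := ih (G := G₁) (κ := κ - 1) hG₁a
      ((hG₁0 0).trans (mul_zero _))
      (by simpa only [hG₁0, mul_one, id] using (hasDerivAt_id (0 : ℂ)).const_mul (κ - 1))
      (fun k hkk => hk (k + 1) (by push_cast; linear_combination hkk))
      (by convert hκ using 2; push_cast; ring)
    refine ⟨fun x => x * (c + s x), by fun_prop, by simp, ?_⟩
    have h1 := eventually_comp_prodMk hg₁e (u := fun x : ℂ => x) (v := fun x => x * (c + s x))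
      (z := 0) continuousAt_id (by have := hs.continuousAt; fun_prop) rfl (by simp)
    filter_upwards [hse, h1, hg₀e, hs.eventually_analyticAt] with x hx hx1 hx2 hx3
    have hd := (hasDerivAt_id x).mul ((hx3.differentiableAt.hasDerivAt).const_add c)
    have hd' : deriv (fun x => x * (c + s x)) x = 1 * (c + s x) + x * deriv s x := hd.deriv
    rw [hd', hx1, hx2, hx]
    ring

/-- **Briot–Bouquet.** -/
theorem exists_briotBouquet {G : ℂ × ℂ → ℂ} {κ : ℂ} (hG : AnalyticAt ℂ G 0) (hG0 : G 0 = 0)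
    (hGκ : HasDerivAt (fun y => G (0, y)) κ 0) (hκ : ∀ k : ℕ, κ ≠ k + 1) :
    ∃ s : ℂ → ℂ, AnalyticAt ℂ s 0 ∧ s 0 = 0 ∧
      ∀ᶠ x in 𝓝 (0 : ℂ), x * deriv s x = G (x, s x) := by
  obtain ⟨m, hm⟩ := exists_nat_gt (2 * ‖κ‖)
  refine exists_briotBouquet_of_norm_lt (m + 1) m hG hG0 hGκ hκ ?_
  rw [Nat.cast_add, Nat.cast_one, sub_add_cancel]
  linarith

theorem exists_implicit {F : ℂ × ℂ → ℂ} {d : ℂ} (hF : AnalyticAt ℂ F 0) (hF0 : F 0 = 0)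
    (hd : HasDerivAt (fun y => F (0, y)) d 0) (hd0 : d ≠ 0) :
    ∃ s : ℂ → ℂ, AnalyticAt ℂ s 0 ∧ s 0 = 0 ∧ ∀ᶠ x in 𝓝 (0 : ℂ), F (x, s x) = 0 := by
  have hFx := hF.fderiv_apply_const (1, 0)
  have hFy := hF.fderiv_apply_const (0, 1)
  have hFy0 : fderiv ℂ F 0 (0, 1) ≠ 0 := by
    rwa [show fderiv ℂ F 0 (0, 1) = d from
      (hasDerivAt_prodMk_snd (x := 0) (y := 0) hF).unique hd]
  obtain ⟨s, hs, hs0, hse⟩ := exists_briotBouquet (κ := 0)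
    (G := fun p => -(p.1 * fderiv ℂ F p (1, 0)) / fderiv ℂ F p (0, 1))
    ((analyticAt_fst.mul hFx).neg.div hFy hFy0) (by simp)
    (by simpa using hasDerivAt_const (0 : ℂ) (0 : ℂ))
    (fun k => by exact_mod_cast (Nat.succ_ne_zero k).symm)
  refine ⟨s, hs, hs0, ?_⟩
  have ha : AnalyticAt ℂ (fun x => F (x, s x)) 0 :=
    analyticAt_comp_prodMk_zero hF analyticAt_id hs rfl hs0
  have hderiv : ∀ᶠ x in 𝓝 (0 : ℂ), deriv (fun x => F (x, s x)) x = 0 := by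
    refine ha.deriv.eventually_eq_zero_of_punctured ?_
    have h1 := eventually_comp_prodMk (hF.eventually_analyticAt.and
      (hFy.continuousAt.eventually_ne hFy0)) (u := fun x : ℂ => x) (v := s)
      continuousAt_id hs.continuousAt rfl hs0
    filter_upwards [eventually_mem_nhdsWithin, ((hse.and h1).and
      hs.eventually_analyticAt).filter_mono nhdsWithin_le_nhds] with x hx0 hx
    obtain ⟨⟨h2, h3, h4⟩, h5⟩ := hx
    have h6 := h3.differentiableAt.hasFDerivAt.comp_hasDerivAt x
      ((hasDerivAt_id x).prodMk h5.differentiableAt.hasDerivAt)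
    have h7 : deriv (fun x => F (x, s x)) x = _ := h6.deriv
    rw [h7, fderiv_apply_prod]
    rw [eq_div_iff h4] at h2
    apply mul_left_cancel₀ (show x ≠ 0 from hx0)
    linear_combination h2
  obtain ⟨ε, hε, hb⟩ := Metric.eventually_nhds_iff_ball.mp (hderiv.and ha.eventually_analyticAt)
  filter_upwards [ball_mem_nhds (0 : ℂ) hε] with x hx
  have := isOpen_ball.is_const_of_deriv_eq_zero (convex_ball (0 : ℂ) ε).isPreconnected
    (fun y hy => (hb y hy).2.differentiableAt.differentiableWithinAt)
    (fun y hy => (hb y hy).1) hx (mem_ball_self hε)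
  rw [this, hs0]
  exact hF0

theorem eventually_iteratedDeriv_const_add_id_mul {f : ℂ → ℂ} (hf : AnalyticAt ℂ f 0) (c : ℂ)
    (n : ℕ) : ∀ᶠ y in 𝓝 (0 : ℂ), iteratedDeriv (n + 1) (fun y => c + y * f y) y =
      y * iteratedDeriv (n + 1) f y + (n + 1) * iteratedDeriv n f y := by
  induction n with
  | zero =>
    filter_upwards [hf.eventually_analyticAt] with y hy
    have h : HasDerivAt (fun y => c + y * f y) (1 * f y + y * deriv f y) y :=
      ((hasDerivAt_id y).mul hy.differentiableAt.hasDerivAt).const_add c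
    rw [zero_add, iteratedDeriv_one, iteratedDeriv_one, iteratedDeriv_zero, h.deriv]
    push_cast; ring
  | succ n ih =>
    filter_upwards [ih.eventually_nhds, hf.eventually_analyticAt] with y hy hfy
    have hi : ∀ k, AnalyticAt ℂ (iteratedDeriv k f) y := fun k => by
      rw [iteratedDeriv_eq_iterate]; exact hfy.iterated_deriv k
    have h : HasDerivAt (fun y => y * iteratedDeriv (n + 1) f y + (n + 1) * iteratedDeriv n f y)
        (1 * iteratedDeriv (n + 1) f y + y * iteratedDeriv (n + 2) f y +
          (n + 1) * iteratedDeriv (n + 1) f y) y := by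
      rw [iteratedDeriv_succ (n := n + 1), iteratedDeriv_succ (n := n)]
      refine ((hasDerivAt_id y).mul ?_).add (HasDerivAt.const_mul _ ?_)
      · rw [← iteratedDeriv_succ]; exact (hi _).differentiableAt.hasDerivAt
      · exact (hi n).differentiableAt.hasDerivAt
    rw [iteratedDeriv_succ, EventuallyEq.deriv_eq hy, h.deriv]
    push_cast; ring

theorem iteratedDeriv_sum_add_pow_mul (K : ℕ) : ∀ {f ρ : ℂ → ℂ} {c : ℕ → ℂ},
    AnalyticAt ℂ ρ 0 →
    (∀ᶠ y in 𝓝 (0 : ℂ), f y = ∑ k ∈ Finset.range K, c k * y ^ k + y ^ K * ρ y) →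
    iteratedDeriv K f 0 = K.factorial * ρ 0 := by
  induction K with
  | zero =>
    intro f ρ c _ h
    simpa using h.self_of_nhds
  | succ K ih =>
    intro f ρ c hρ h
    set f₁ : ℂ → ℂ := fun y => ∑ k ∈ Finset.range K, c (k + 1) * y ^ k + y ^ K * ρ y with hf₁
    have hf₁a : AnalyticAt ℂ f₁ 0 := by
      refine AnalyticAt.add (Finset.analyticAt_fun_sum _ fun k _ => by fun_prop) (by fun_prop)
    have h1 : f =ᶠ[𝓝 0] fun y => c 0 + y * f₁ y := by
      filter_upwards [h] with y hy
      rw [hy, Finset.sum_range_succ', hf₁]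
      simp only [mul_add, Finset.mul_sum]
      rw [Finset.sum_congr rfl fun k _ => show y * (c (k + 1) * y ^ k) = c (k + 1) * y ^ (k + 1) by
        ring]
      ring
    rw [h1.iteratedDeriv_eq, (eventually_iteratedDeriv_const_add_id_mul hf₁a _ K).self_of_nhds,
      ih (f := f₁) hρ (Eventually.of_forall fun y => rfl), Nat.factorial_succ]
    push_cast; ring

/-- Iterated partial derivatives with respect to the second variable are analytic. -/
theorem AnalyticAt.iteratedDeriv_snd {F : ℂ × ℂ → ℂ} {p : ℂ × ℂ} (hF : AnalyticAt ℂ F p) (k : ℕ) :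
    AnalyticAt ℂ (fun q => iteratedDeriv k (fun y => F (q.1, y)) q.2) p := by
  induction k with
  | zero => simpa using hF
  | succ k ih =>
    refine (ih.fderiv_apply_const (0, 1)).congr ?_
    filter_upwards [ih.eventually_analyticAt] with q hq
    rw [iteratedDeriv_succ]
    exact ((hasDerivAt_prodMk_snd (x := q.1) (y := q.2) hq).deriv).symm

theorem exists_tschirnhaus {A : ℂ × ℂ → ℂ} (hA : AnalyticAt ℂ A 0) {J : ℕ} {g : ℂ → ℂ}
    (hg : AnalyticAt ℂ g 0) (hg0 : g 0 ≠ 0)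
    (h : ∀ᶠ y in 𝓝 (0 : ℂ), A (0, y) = y ^ (J + 1) * g y) :
    ∃ s : ℂ → ℂ, AnalyticAt ℂ s 0 ∧ s 0 = 0 ∧
      ∀ᶠ x in 𝓝 (0 : ℂ), iteratedDeriv J (fun y => A (x, y + s x)) 0 = 0 := by
  have hF := hA.iteratedDeriv_snd J
  have h0 : iteratedDeriv J (fun y => A (0, y)) 0 = 0 := by
    rw [iteratedDeriv_sum_add_pow_mul J (ρ := fun y => y * g y) (c := fun _ => 0) (by fun_prop)]
    · simp
    · filter_upwards [h] with y hy
      rw [hy]; simp; ring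
  have h1 : iteratedDeriv (J + 1) (fun y => A (0, y)) 0 = (J + 1).factorial * g 0 :=
    iteratedDeriv_sum_add_pow_mul (J + 1) (c := fun _ => 0) hg (by
      filter_upwards [h] with y hy
      rw [hy]; simp)
  have hd : HasDerivAt (fun y => iteratedDeriv J (fun y => A (0, y)) y)
      ((J + 1).factorial * g 0) 0 := by
    rw [← h1, iteratedDeriv_succ]
    exact (hasDerivAt_prodMk_snd (x := 0) (y := 0) hF).differentiableAt.hasDerivAt
  obtain ⟨s, hs, hs0, hse⟩ := exists_implicit hF h0 hd
    (mul_ne_zero (by exact_mod_cast Nat.factorial_ne_zero _) hg0)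
  refine ⟨s, hs, hs0, ?_⟩
  filter_upwards [hse] with x hx
  have := congrFun (iteratedDeriv_comp_add_const J (fun y => A (x, y)) (s x)) 0
  rw [this]
  simpa using hx

theorem exists_sum_add_pow_mul (K : ℕ) : ∀ {F : ℂ × ℂ → ℂ} {g : ℂ → ℂ}, AnalyticAt ℂ F 0 →
    AnalyticAt ℂ g 0 → (∀ᶠ y in 𝓝 (0 : ℂ), F (0, y) = y ^ K * g y) →
    ∃ (a : ℕ → ℂ → ℂ) (R : ℂ × ℂ → ℂ), (∀ k, AnalyticAt ℂ (a k) 0) ∧ (∀ k, a k 0 = 0) ∧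
      AnalyticAt ℂ R 0 ∧ R 0 = g 0 ∧
      ∀ᶠ p : ℂ × ℂ in 𝓝 0, F p = ∑ k ∈ Finset.range K, a k p.1 * p.2 ^ k + p.2 ^ K * R p := by
  induction K with
  | zero =>
    intro F g hF _ h
    refine ⟨fun _ _ => 0, F, fun _ => analyticAt_const, fun _ => rfl, hF, ?_, ?_⟩
    · have := h.self_of_nhds
      rwa [pow_zero, one_mul] at this
    · simp
  | succ K ih =>
    intro F g hF hg h
    obtain ⟨F₁, hF₁, hF₁e⟩ := hF.exists_div_snd
    have hF0 : F (0, 0) = 0 := by simpa using h.self_of_nhds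
    have hF₁0 : ∀ᶠ y in 𝓝 (0 : ℂ), F₁ (0, y) = y ^ K * g y := by
      have ha : AnalyticAt ℂ (fun y => F₁ (0, y) - y ^ K * g y) 0 :=
        (analyticAt_comp_prodMk_zero hF₁ analyticAt_const analyticAt_id rfl rfl).sub (by fun_prop)
      refine (ha.eventually_eq_zero_of_punctured ?_).mono fun y hy => sub_eq_zero.mp hy
      filter_upwards [eventually_mem_nhdsWithin, (h.and (eventually_comp_prodMk hF₁e
        (u := fun _ : ℂ => 0) (v := fun y => y) continuousAt_const continuousAt_id rfl
        rfl)).filter_mono nhdsWithin_le_nhds] with y hy0 hy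
      apply mul_left_cancel₀ (show y ≠ 0 from hy0)
      have h1 := hy.2
      rw [hy.1, hF0] at h1
      linear_combination -h1
    obtain ⟨a, R, ha, ha0, hR, hR0, hRe⟩ := ih hF₁ hg hF₁0
    refine ⟨fun k => Nat.casesOn k (fun x => F (x, 0)) a, R, ?_, ?_, hR, hR0, ?_⟩
    · rintro (_ | k)
      · exact analyticAt_comp_prodMk_zero hF analyticAt_id analyticAt_const rfl rfl
      · exact ha k
    · rintro (_ | k)
      · exact hF0
      · exact ha0 k
    · filter_upwards [hF₁e, hRe] with p hp hp'
      rw [hp, hp', Finset.sum_range_succ']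
      change _ = ∑ k ∈ Finset.range K, a k p.1 * p.2 ^ (k + 1) + F (p.1, 0) * p.2 ^ 0 + _
      simp only [mul_add, Finset.mul_sum]
      rw [Finset.sum_congr rfl fun k _ => show p.2 * (a k p.1 * p.2 ^ k) =
        a k p.1 * p.2 ^ (k + 1) by ring]
      ring

open Polynomial in
/-- If `N` and `P` have no common root, some root `c` of `P` is such that the inverse of the residue
of `N / P` at `c` is not a positive rational. -/
theorem exists_good_root_of_coprime {N P : ℂ[X]} {J : ℕ} (hN : N.natDegree ≤ J)
    (hP : P.natDegree = J + 1) (hr : ∀ q : ℚ, 0 ≤ q → N.coeff J ≠ q * P.leadingCoeff)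
    (hco : ∀ c, P.eval c = 0 → N.eval c ≠ 0) :
    ∃ (c : ℂ) (P₁ : ℂ[X]), P = (X - C c) * P₁ ∧ N.eval c ≠ 0 ∧
      ∀ q : ℚ, 0 < q → P₁.eval c ≠ q * N.eval c := by
  classical
  by_contra! hbad
  have hP0 : P ≠ 0 := by rintro rfl; simp at hP
  have hbad' : ∀ c P₁, P = (X - C c) * P₁ → ∃ q : ℚ, 0 < q ∧ P₁.eval c = q * N.eval c :=
    fun c P₁ h => hbad c P₁ h (hco c (by rw [h]; simp))
  have hnodup : P.roots.Nodup := by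
    rw [Multiset.nodup_iff_count_le_one]
    intro c
    rw [count_roots]
    by_contra! hlt
    obtain ⟨Q, hQ⟩ := (le_rootMultiplicity_iff hP0).mp (Nat.succ_le_of_lt hlt)
    have hQ' : P = (X - C c) * ((X - C c) * Q) := by
      rw [hQ, show Nat.succ 1 = 2 from rfl, pow_two, mul_assoc]
    obtain ⟨q, hq, hqe⟩ := hbad' c _ hQ'
    have hNc : N.eval c ≠ 0 := hco c (by rw [hQ']; simp)
    have hq0 : (q : ℂ) ≠ 0 := by exact_mod_cast hq.ne'
    rw [eval_mul, eval_sub, eval_X, eval_C, sub_self, zero_mul] at hqe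
    exact mul_ne_zero hq0 hNc hqe.symm
  set s := P.roots.toFinset with hs
  have hcard : s.card = J + 1 := by
    rw [hs, Multiset.toFinset_card_of_nodup hnodup, ← hP]
    exact (IsAlgClosed.splits P).natDegree_eq_card_roots.symm
  have hprod : P = C P.leadingCoeff * ∏ c ∈ s, (X - C c) := by
    have h1 := (IsAlgClosed.splits P).eq_prod_roots
    rw [Finset.prod, hs, Multiset.toFinset_val, hnodup.dedup]
    exact h1
  have hq : ∀ c ∈ s, ∃ q : ℚ, 0 < q ∧
      N.eval c / ∏ j ∈ s.erase c, (c - j) = q * P.leadingCoeff := by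
    intro c hc
    have h1 : P = (X - C c) * (C P.leadingCoeff * ∏ j ∈ s.erase c, (X - C j)) := by
      conv_lhs => rw [hprod, ← Finset.mul_prod_erase s _ hc]
      ring
    obtain ⟨q, hq, hqe⟩ := hbad' c _ h1
    have hq0 : (q : ℂ) ≠ 0 := by exact_mod_cast hq.ne'
    have hne : ∏ j ∈ s.erase c, (c - j) ≠ 0 :=
      Finset.prod_ne_zero_iff.mpr fun j hj => sub_ne_zero.mpr (Finset.ne_of_mem_erase hj).symm
    refine ⟨q⁻¹, inv_pos.mpr hq, ?_⟩
    rw [eval_mul, eval_C, eval_prod] at hqe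
    simp only [eval_sub, eval_X, eval_C] at hqe
    rw [div_eq_iff hne, Rat.cast_inv, mul_assoc, hqe, inv_mul_cancel_left₀ hq0]
  choose! q hqpos hqe using hq
  have hlag := Lagrange.coeff_eq_sum (s := s) (v := id) (Set.injOn_id _) (P := N) (by
    rw [hcard]
    exact (natDegree_le_iff_degree_le.mp hN).trans_lt (by exact_mod_cast Nat.lt_succ_self J))
  rw [hcard, Nat.add_sub_cancel] at hlag
  refine hr (∑ c ∈ s, q c) (Finset.sum_nonneg fun c hc => (hqpos c hc).le) ?_
  rw [hlag, Rat.cast_sum, Finset.sum_mul]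
  exact Finset.sum_congr rfl fun c hc => hqe c hc

open Polynomial in
theorem exists_good_root (J : ℕ) : ∀ {N P : ℂ[X]}, N.natDegree ≤ J → P.natDegree = J + 1 →
    (∀ q : ℚ, 0 ≤ q → N.coeff J ≠ q * P.leadingCoeff) →
    ∃ (c : ℂ) (J' : ℕ) (N₁ P₁ : ℂ[X]), N = (X - C c) ^ J' * N₁ ∧ P = (X - C c) ^ (J' + 1) * P₁ ∧
      N₁.eval c ≠ 0 ∧ ∀ q : ℚ, 0 < q → P₁.eval c ≠ q * N₁.eval c := by
  induction J with
  | zero =>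
    intro N P hN hP hr
    have hN' := eq_C_of_natDegree_le_zero hN
    obtain ⟨c, P₁, h1, h2, h3⟩ := exists_good_root_of_coprime hN hP hr (fun c _ => by
      rw [hN', eval_C]
      simpa using hr 0 le_rfl)
    exact ⟨c, 0, N, P₁, by simp, by simpa using h1, h2, h3⟩
  | succ J ih =>
    intro N P hN hP hr
    by_cases hco : ∀ c, P.eval c = 0 → N.eval c ≠ 0
    · obtain ⟨c, P₁, h1, h2, h3⟩ := exists_good_root_of_coprime hN hP hr hco
      exact ⟨c, 0, N, P₁, by simp, by simpa using h1, h2, h3⟩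
    · push Not at hco
      obtain ⟨c, hPc, hNc⟩ := hco
      obtain ⟨N', hN'⟩ := dvd_iff_isRoot.mpr hNc
      obtain ⟨P', hP'⟩ := dvd_iff_isRoot.mpr hPc
      have hNcoeff : N.coeff (J + 1) ≠ 0 := by simpa using hr 0 le_rfl
      have hN0 : N' ≠ 0 := by
        rintro rfl
        rw [hN', mul_zero, coeff_zero] at hNcoeff
        exact hNcoeff rfl
      have hP0 : P' ≠ 0 := by rintro rfl; simp [hP'] at hP
      have hNd : N'.natDegree ≤ J := by
        rw [hN', natDegree_mul (X_sub_C_ne_zero c) hN0, natDegree_X_sub_C] at hN; omega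
      have hPd : P'.natDegree = J + 1 := by
        rw [hP', natDegree_mul (X_sub_C_ne_zero c) hP0, natDegree_X_sub_C] at hP; omega
      have hNc' : N.coeff (J + 1) = N'.coeff J := by
        rw [hN', add_comm, coeff_mul_add_eq_of_natDegree_le (natDegree_X_sub_C_le c) hNd]
        simp
      have hPl : P.leadingCoeff = P'.leadingCoeff := by
        rw [hP', leadingCoeff_mul, leadingCoeff_X_sub_C, one_mul]
      obtain ⟨d, J', N₁, P₁, h1, h2, h3, h4⟩ := ih hNd hPd (by rwa [hNc', hPl] at hr)
      by_cases hcd : d = c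
      · subst hcd
        exact ⟨d, J' + 1, N₁, P₁, by rw [hN', h1]; ring, by rw [hP', h2]; ring, h3, h4⟩
      · have hne : d - c ≠ 0 := sub_ne_zero.mpr hcd
        refine ⟨d, J', (X - C c) * N₁, (X - C c) * P₁, by rw [hN', h1]; ring,
          by rw [hP', h2]; ring, ?_, fun q hq => ?_⟩
        · simpa [hne] using h3
        · intro h5
          apply h4 q hq
          simp only [eval_mul, eval_sub, eval_X, eval_C] at h5
          apply mul_left_cancel₀ hne
          linear_combination h5

theorem PuiseuxSolution.of_translate {A B : ℂ × ℂ → ℂ} {s φ : ℂ → ℂ} {n : ℕ}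
    (hs : AnalyticAt ℂ s 0) (hs0 : s 0 = 0)
    (h : PuiseuxSolution (fun p => A (p.1, p.2 + s p.1))
      (fun p => B (p.1, p.2 + s p.1) - p.1 * deriv s p.1 * A (p.1, p.2 + s p.1)) n φ) :
    PuiseuxSolution A B n (fun t => φ t + s (t ^ n)) := by
  have hn := h.ne_zero
  have hpow : Tendsto (fun t : ℂ => t ^ n) (𝓝 0) (𝓝 0) :=
    (continuous_pow n).tendsto' 0 0 (zero_pow hn)
  refine ⟨hn, h.analyticAt.add (AnalyticAt.fun_comp (g := s) (f := fun t => t ^ n)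
    (by simpa [hn] using hs) (by fun_prop)), by simp [hn, h.map_zero, hs0], ?_⟩
  filter_upwards [h.eventually_eq, h.analyticAt.eventually_analyticAt,
    hpow.eventually hs.eventually_analyticAt] with t h1 h2 h3
  have hd := (h2.differentiableAt.hasDerivAt).add
    (h3.differentiableAt.hasDerivAt.comp t (hasDerivAt_pow n t))
  have hd' : deriv (fun t => φ t + s (t ^ n)) t = _ := hd.deriv
  have ht : t ^ n = t * t ^ (n - 1) := by
    rw [← pow_succ', Nat.sub_add_cancel (Nat.pos_of_ne_zero hn)]
  rw [hd']
  simp only [ht] at h1 ⊢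
  linear_combination h1

theorem PuiseuxSolution.of_blowup {A B A' B' : ℂ × ℂ → ℂ} {ψ : ℂ → ℂ} {n p q J : ℕ} {c : ℂ}
    (hp : p ≠ 0) (hq : q ≠ 0)
    (hA : ∀ᶠ v : ℂ × ℂ in 𝓝 0, A (v.1 ^ p, v.1 ^ q * (c + v.2)) = v.1 ^ (q * J) * A' v)
    (hB : ∀ᶠ v : ℂ × ℂ in 𝓝 0, p * B (v.1 ^ p, v.1 ^ q * (c + v.2)) =
      v.1 ^ (q * (J + 1)) * (B' v + q * (c + v.2) * A' v))
    (h : PuiseuxSolution A' B' n ψ) :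
    PuiseuxSolution A B (n * p) (fun t => t ^ (n * q) * (c + ψ t)) := by
  have hn := h.ne_zero
  have hψ := h.analyticAt
  have hnq : n * q ≠ 0 := mul_ne_zero hn hq
  refine ⟨mul_ne_zero hn hp, by fun_prop, by simp [hnq], ?_⟩
  filter_upwards [h.eventually_eq, hψ.eventually_analyticAt,
    eventually_comp_prodMk (hA.and hB) (u := fun t : ℂ => t ^ n) (v := ψ) (z := 0)
      (by fun_prop) hψ.continuousAt (zero_pow hn) h.map_zero] with t h1 h2 h3
  obtain ⟨h3, h4⟩ := h3
  have hd := (hasDerivAt_pow (n * q) t).mul ((h2.differentiableAt.hasDerivAt).const_add c)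
  have hd' : deriv (fun t => t ^ (n * q) * (c + ψ t)) t = _ := hd.deriv
  have ht : t * t ^ (n * q - 1) = t ^ (n * q) := by
    rw [← pow_succ', Nat.sub_add_cancel (Nat.pos_of_ne_zero hnq)]
  simp only [← pow_mul] at h3 h4
  rw [hd', h3]
  rw [show n * (q * (J + 1)) = n * (q * J) + n * q by ring, pow_add] at h4
  push_cast
  linear_combination (t ^ (n * (q * J)) * A' (t ^ n, ψ t) * n * q * (c + ψ t)) * ht +
    (t ^ (n * (q * J)) * t ^ (n * q)) * h1 - n * h4

/-- Choice of the slope of the Newton polygon for a finite weighted family. -/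
theorem exists_slope {ι : Type*} (S : Finset ι) (f : ι → ℂ → ℂ) (w : ι → ℕ)
    (hf : ∀ i ∈ S, AnalyticAt ℂ (f i) 0) (hf0 : ∀ i ∈ S, f i 0 = 0) (hw : ∀ i ∈ S, w i ≠ 0)
    (hne : ∃ i ∈ S, ¬ ∀ᶠ x in 𝓝 (0 : ℂ), f i x = 0) :
    ∃ (p q : ℕ) (F : ι → ℂ → ℂ), p ≠ 0 ∧ q ≠ 0 ∧ (∀ i ∈ S, AnalyticAt ℂ (F i) 0) ∧
      (∀ i ∈ S, ∀ᶠ t in 𝓝 (0 : ℂ), f i (t ^ p) = t ^ (q * w i) * F i t) ∧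
      ∃ i ∈ S, F i 0 ≠ 0 := by
  classical
  have hfac : ∀ i ∈ S, (¬ ∀ᶠ x in 𝓝 (0 : ℂ), f i x = 0) → ∃ (m : ℕ) (u : ℂ → ℂ), m ≠ 0 ∧
      AnalyticAt ℂ u 0 ∧ u 0 ≠ 0 ∧ ∀ᶠ x in 𝓝 (0 : ℂ), f i x = x ^ m * u x := by
    intro i hi hi0
    obtain ⟨m, u, hu, hu0, hue⟩ := (hf i hi).exists_eventuallyEq_pow_smul_nonzero_iff.mpr hi0
    refine ⟨m, u, ?_, hu, hu0, by simpa using hue⟩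
    rintro rfl
    have := hue.self_of_nhds
    rw [hf0 i hi] at this
    simp only [pow_zero, one_smul] at this
    exact hu0 this.symm
  choose! m u hm hu hu0 hue using hfac
  set T := S.filter fun i => ¬ ∀ᶠ x in 𝓝 (0 : ℂ), f i x = 0 with hT
  have hTne : T.Nonempty := by
    obtain ⟨i, hi, hi0⟩ := hne
    exact ⟨i, Finset.mem_filter.mpr ⟨hi, hi0⟩⟩
  obtain ⟨i₀, hi₀, hmin⟩ := T.exists_min_image (fun i => (m i : ℚ) / w i) hTne
  obtain ⟨hi₀S, hi₀n⟩ := Finset.mem_filter.mp hi₀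
  have hle : ∀ i ∈ S, (¬ ∀ᶠ x in 𝓝 (0 : ℂ), f i x = 0) → m i₀ * w i ≤ w i₀ * m i := by
    intro i hi hin
    have h1 := hmin i (Finset.mem_filter.mpr ⟨hi, hin⟩)
    have hw0 : (0 : ℚ) < w i₀ := by exact_mod_cast Nat.pos_of_ne_zero (hw i₀ hi₀S)
    have hwi : (0 : ℚ) < w i := by exact_mod_cast Nat.pos_of_ne_zero (hw i hi)
    rw [div_le_div_iff₀ hw0 hwi] at h1
    rw [mul_comm (w i₀)]
    exact_mod_cast h1
  have hp := hw i₀ hi₀S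
  have hpow : Tendsto (fun t : ℂ => t ^ w i₀) (𝓝 0) (𝓝 0) :=
    (continuous_pow _).tendsto' 0 0 (zero_pow hp)
  refine ⟨w i₀, m i₀, fun i t => if ∀ᶠ x in 𝓝 (0 : ℂ), f i x = 0 then 0 else
    t ^ (w i₀ * m i - m i₀ * w i) * u i (t ^ w i₀), hp, hm i₀ hi₀S hi₀n, fun i hi => ?_,
    fun i hi => ?_, i₀, hi₀S, ?_⟩
  · by_cases hin : ∀ᶠ x in 𝓝 (0 : ℂ), f i x = 0
    · simpa only [hin, if_true] using analyticAt_const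
    · simp only [hin, if_false]
      have : AnalyticAt ℂ (fun t => u i (t ^ w i₀)) 0 :=
        AnalyticAt.fun_comp (g := u i) (f := fun t => t ^ w i₀)
          (by rw [zero_pow hp]; exact hu i hi hin) (by fun_prop)
      exact (analyticAt_id.pow _).mul this
  · by_cases hin : ∀ᶠ x in 𝓝 (0 : ℂ), f i x = 0
    · simp only [hin, if_true, mul_zero]
      exact hpow.eventually hin
    · simp only [hin, if_false]
      filter_upwards [hpow.eventually (hue i hi hin)] with t ht
      rw [ht, ← mul_assoc, ← pow_add, Nat.add_sub_cancel' (hle i hi hin), ← pow_mul]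
  · simp only [hi₀n, if_false]
    rw [mul_comm (m i₀), Nat.sub_self, pow_zero, one_mul, zero_pow hp]
    exact hu0 i₀ hi₀S hi₀n

section Polynomial

open Polynomial

/-- The polynomial with coefficients `c k` for `k < K` and `l` for `k = K`. -/
noncomputable def newtonPoly (c : ℕ → ℂ) (K : ℕ) (l : ℂ) : ℂ[X] :=
  ∑ k ∈ Finset.range K, C (c k) * X ^ k + C l * X ^ K

theorem eval_newtonPoly (c : ℕ → ℂ) (K : ℕ) (l u : ℂ) :
    (newtonPoly c K l).eval u = ∑ k ∈ Finset.range K, c k * u ^ k + l * u ^ K := by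
  simp [newtonPoly, eval_finsetSum]

theorem coeff_newtonPoly_of_lt {c : ℕ → ℂ} {K k : ℕ} {l : ℂ} (hk : k < K) :
    (newtonPoly c K l).coeff k = c k := by
  simp [newtonPoly, finsetSum_coeff, coeff_C_mul, coeff_X_pow, hk, hk.ne]

theorem coeff_newtonPoly_self (c : ℕ → ℂ) (K : ℕ) (l : ℂ) :
    (newtonPoly c K l).coeff K = l := by
  simp [newtonPoly, finsetSum_coeff, coeff_C_mul, coeff_X_pow]

theorem natDegree_newtonPoly_le (c : ℕ → ℂ) (K : ℕ) (l : ℂ) :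
    (newtonPoly c K l).natDegree ≤ K := by
  refine natDegree_add_le_of_degree_le (natDegree_sum_le_of_forall_le _ _ fun k hk => ?_)
    (natDegree_C_mul_X_pow_le _ _)
  exact (natDegree_C_mul_X_pow_le _ _).trans (Finset.mem_range.mp hk).le

/-- One step of the reduction at the level of initial polynomials. -/
theorem exists_reduced_root {J p q : ℕ} {α β : ℕ → ℂ} {g₀ h₀ : ℂ} (hp : p ≠ 0) (hq : q ≠ 0)
    (hg₀ : g₀ ≠ 0) (hh₀ : ∀ r : ℚ, 0 < r → h₀ ≠ r * g₀) (hα : α J = 0)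
    (hne : (∃ k < J + 1, α k ≠ 0) ∨ ∃ k < J + 2, β k ≠ 0) :
    ∃ (c : ℂ) (J' : ℕ) (N₁ P₁ : ℂ[X]), J' < J + 1 ∧
      newtonPoly α (J + 1) g₀ = (X - C c) ^ J' * N₁ ∧
      C (p : ℂ) * newtonPoly β (J + 2) h₀ - C (q : ℂ) * X * newtonPoly α (J + 1) g₀ =
        (X - C c) ^ (J' + 1) * P₁ ∧
      N₁.eval c ≠ 0 ∧ ∀ r : ℚ, 0 < r → P₁.eval c ≠ r * N₁.eval c := by
  set N := newtonPoly α (J + 1) g₀ with hN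
  set P := C (p : ℂ) * newtonPoly β (J + 2) h₀ - C (q : ℂ) * X * N with hP
  have hpC : (p : ℂ) ≠ 0 := by exact_mod_cast hp
  have hNd : N.natDegree ≤ J + 1 := natDegree_newtonPoly_le _ _ _
  have hNJ : N.coeff (J + 1) = g₀ := coeff_newtonPoly_self _ _ _
  have hPs : ∀ k, P.coeff (k + 1) =
      p * (newtonPoly β (J + 2) h₀).coeff (k + 1) - q * N.coeff k := by
    intro k
    rw [hP, coeff_sub, coeff_C_mul, mul_assoc, coeff_C_mul, coeff_X_mul]
  have hPz : P.coeff 0 = p * (newtonPoly β (J + 2) h₀).coeff 0 := by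
    rw [hP, coeff_sub, coeff_C_mul, mul_assoc, coeff_C_mul, coeff_X_mul_zero, mul_zero, sub_zero]
  have hPl : P.coeff (J + 2) = p * h₀ - q * g₀ := by
    rw [hPs, hNJ, coeff_newtonPoly_self]
  have hPl0 : P.coeff (J + 2) ≠ 0 := by
    rw [hPl]
    intro h
    refine hh₀ (q / p) (by positivity) ?_
    push_cast
    field_simp
    linear_combination h
  have hPd : P.natDegree = J + 2 := by
    refine natDegree_eq_of_le_of_coeff_ne_zero ?_ hPl0
    refine (natDegree_sub_le_of_le ((natDegree_C_mul_le _ _).trans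
      (natDegree_newtonPoly_le _ _ _)) (n := J + 2) ?_).trans (max_self _).le
    rw [mul_assoc]
    refine (natDegree_C_mul_le _ _).trans ((natDegree_mul_le).trans ?_)
    rw [natDegree_X]; omega
  have hPlc : P.leadingCoeff = p * h₀ - q * g₀ := by rw [leadingCoeff, hPd, hPl]
  obtain ⟨c, J', N₁, P₁, h1, h2, h3, h4⟩ := exists_good_root (J + 1) hNd hPd (by
    intro r hr h
    rw [hNJ, hPlc] at h
    have hr0 : r ≠ 0 := by
      rintro rfl
      rw [Rat.cast_zero, zero_mul] at h
      exact hg₀ h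
    have hrpos : 0 < r := lt_of_le_of_ne hr hr0.symm
    have hrC : (r : ℂ) ≠ 0 := by exact_mod_cast hr0
    refine hh₀ ((1 + r * q) / (r * p)) (by positivity) ?_
    push_cast
    field_simp
    linear_combination -h)
  refine ⟨c, J', N₁, P₁, ?_, h1, h2, h3, h4⟩
  have hN0 : N ≠ 0 := by intro h; rw [h, coeff_zero] at hNJ; exact hg₀ hNJ.symm
  have hP0 : P ≠ 0 := by intro h; rw [h, coeff_zero] at hPl0; exact hPl0 rfl
  have hN₁0 : N₁ ≠ 0 := by rintro rfl; exact hN0 (by rw [h1, mul_zero])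
  have hP₁0 : P₁ ≠ 0 := by rintro rfl; exact hP0 (by rw [h2, mul_zero])
  have hdN : N.natDegree = J' + N₁.natDegree := by
    rw [h1, natDegree_mul (pow_ne_zero _ (X_sub_C_ne_zero c)) hN₁0, natDegree_pow,
      natDegree_X_sub_C, mul_one]
  have hdP : P.natDegree = J' + 1 + P₁.natDegree := by
    rw [h2, natDegree_mul (pow_ne_zero _ (X_sub_C_ne_zero c)) hP₁0, natDegree_pow,
      natDegree_X_sub_C, mul_one]
  by_contra! hJ
  have hJ' : J' = J + 1 := by omega
  subst hJ'
  have hN₁C := eq_C_of_natDegree_eq_zero (show N₁.natDegree = 0 by omega)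
  have hP₁C := eq_C_of_natDegree_eq_zero (show P₁.natDegree = 0 by omega)
  have hn0 : N₁.coeff 0 ≠ 0 := by
    rw [hN₁C, eval_C] at h3; exact h3
  have hc : c = 0 := by
    have h5 : N.coeff J = 0 := by rw [hN, coeff_newtonPoly_of_lt (Nat.lt_succ_self J), hα]
    rw [h1, hN₁C, coeff_mul_C, sub_eq_add_neg, ← C_neg, coeff_X_add_C_pow] at h5
    simpa [hn0, Nat.cast_add_one_ne_zero] using h5
  subst hc
  have hNk : ∀ k < J + 1, N.coeff k = 0 := by
    intro k hk
    rw [h1, hN₁C, C_0, sub_zero, coeff_mul_C, coeff_X_pow, if_neg hk.ne, zero_mul]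
  have hPk : ∀ k < J + 2, P.coeff k = 0 := by
    intro k hk
    rw [h2, hP₁C, C_0, sub_zero, coeff_mul_C, coeff_X_pow, if_neg hk.ne, zero_mul]
  rcases hne with ⟨k, hk, hk0⟩ | ⟨k, hk, hk0⟩
  · apply hk0
    rw [← coeff_newtonPoly_of_lt (c := α) (l := g₀) hk]
    exact hNk k hk
  · apply hk0
    rw [← coeff_newtonPoly_of_lt (c := β) (l := h₀) hk]
    apply mul_left_cancel₀ hpC
    rw [mul_zero]
    cases k with
    | zero => rw [← hPz, hPk 0 hk]
    | succ k =>
      have := hPs k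
      rw [hPk _ hk, hNk k (by omega)] at this
      linear_combination -this

end Polynomial

/-- The case of a vector field which is transverse to the fibres up to the factor `x`. -/
theorem exists_puiseuxSolution_of_ne_zero {A B : ℂ × ℂ → ℂ} {h : ℂ → ℂ} (hA : AnalyticAt ℂ A 0)
    (hB : AnalyticAt ℂ B 0) (hh : AnalyticAt ℂ h 0)
    (hB0 : ∀ᶠ y in 𝓝 (0 : ℂ), B (0, y) = y * h y) (hA0 : A 0 ≠ 0)
    (hr : ∀ r : ℚ, 0 < r → h 0 ≠ r * A 0) : ∃ n φ, PuiseuxSolution A B n φ := by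
  have hA0y : AnalyticAt ℂ (fun y => A (0, y)) 0 :=
    analyticAt_comp_prodMk_zero hA analyticAt_const analyticAt_id rfl rfl
  have hBz : B 0 = 0 := by
    have := hB0.self_of_nhds
    rw [zero_mul] at this
    exact this
  have hd : HasDerivAt (fun y => B (0, y) / A (0, y)) (h 0 / A 0) 0 := by
    have hq : AnalyticAt ℂ (fun y => h y / A (0, y)) 0 := hh.div hA0y hA0
    have h1 := (hasDerivAt_id (0 : ℂ)).mul hq.differentiableAt.hasDerivAt
    refine (h1.congr_deriv ?_).congr_of_eventuallyEq ?_
    · simp only [id, one_mul, zero_mul, add_zero]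
      rfl
    · filter_upwards [hB0] with y hy
      rw [hy]
      exact mul_div_assoc _ _ _
  obtain ⟨s, hs, hs0, hse⟩ := exists_briotBouquet (G := fun p => B p / A p) (hB.div hA hA0)
    (by rw [hBz, zero_div]) hd (fun k hk => hr (k + 1) (by positivity) (by
      rw [div_eq_iff hA0] at hk
      exact_mod_cast hk))
  refine ⟨1, s, one_ne_zero, hs, hs0, ?_⟩
  filter_upwards [hse, eventually_comp_prodMk (hA.continuousAt.eventually_ne hA0)
    (u := fun t : ℂ => t) (v := s) continuousAt_id hs.continuousAt rfl hs0] with t h1 h2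
  rw [pow_one, h1, Nat.cast_one, one_mul, mul_div_cancel₀ _ h2]

theorem eventually_coeff_eq_zero {A R : ℂ × ℂ → ℂ} {a : ℕ → ℂ → ℂ} {J : ℕ}
    (hR : AnalyticAt ℂ R 0)
    (hdec : ∀ᶠ p : ℂ × ℂ in 𝓝 0,
      A p = ∑ k ∈ Finset.range (J + 1), a k p.1 * p.2 ^ k + p.2 ^ (J + 1) * R p)
    (h0 : ∀ᶠ x in 𝓝 (0 : ℂ), iteratedDeriv J (fun y => A (x, y)) 0 = 0) :
    ∀ᶠ x in 𝓝 (0 : ℂ), a J x = 0 := by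
  filter_upwards [h0, eventually_comp_prodMk (hdec.eventually_nhds.and hR.eventually_analyticAt)
    (u := fun x : ℂ => x) (v := fun _ => 0) continuousAt_id continuousAt_const rfl rfl]
    with x h1 h2
  have hc : Tendsto (fun y : ℂ => (x, y)) (𝓝 0) (𝓝 (x, 0)) :=
    (Continuous.prodMk_right x).tendsto' _ _ rfl
  have hRx : AnalyticAt ℂ (fun y => R (x, y)) 0 :=
    analyticAt_comp_prodMk h2.2 analyticAt_const analyticAt_id
  have h3 := iteratedDeriv_sum_add_pow_mul J (f := fun y => A (x, y))
    (ρ := fun y => a J x + y * R (x, y)) (c := fun k => a k x)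
    (analyticAt_const.add (analyticAt_id.mul hRx)) (by
      filter_upwards [hc.eventually h2.1] with y hy
      rw [hy, Finset.sum_range_succ]
      ring)
  rw [h1, zero_mul, add_zero, eq_comm] at h3
  exact (mul_eq_zero.mp h3).resolve_left (by exact_mod_cast Nat.factorial_ne_zero J)

theorem exists_puiseuxSolution (J : ℕ) : ∀ {A B : ℂ × ℂ → ℂ} {g h : ℂ → ℂ}, AnalyticAt ℂ A 0 →
    AnalyticAt ℂ B 0 → AnalyticAt ℂ g 0 → AnalyticAt ℂ h 0 →
    (∀ᶠ y in 𝓝 (0 : ℂ), A (0, y) = y ^ J * g y) →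
    (∀ᶠ y in 𝓝 (0 : ℂ), B (0, y) = y ^ (J + 1) * h y) → g 0 ≠ 0 →
    (∀ r : ℚ, 0 < r → h 0 ≠ r * g 0) → ∃ n φ, PuiseuxSolution A B n φ := by
  induction J using Nat.strong_induction_on with
  | _ J ih =>
  intro A B g h hA hB hg hh hAg hBh hg0 hr
  obtain _ | J := J
  · have hA0 : A 0 = g 0 := by
      have := hAg.self_of_nhds
      rw [pow_zero, one_mul] at this
      exact this
    exact exists_puiseuxSolution_of_ne_zero hA hB hh (by simpa using hBh) (hA0 ▸ hg0) (hA0 ▸ hr)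
  obtain ⟨s, hs, hs0, hsA⟩ := exists_tschirnhaus hA hg hg0 hAg
  set A₁ : ℂ × ℂ → ℂ := fun p => A (p.1, p.2 + s p.1) with hA₁
  set B₁ : ℂ × ℂ → ℂ := fun p => B (p.1, p.2 + s p.1) -
    p.1 * deriv s p.1 * A (p.1, p.2 + s p.1) with hB₁
  suffices ∃ n φ, PuiseuxSolution A₁ B₁ n φ by
    obtain ⟨n, φ, hφ⟩ := this
    exact ⟨n, _, hφ.of_translate hs hs0⟩
  have hsf : AnalyticAt ℂ (fun p : ℂ × ℂ => s p.1) 0 :=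
    AnalyticAt.fun_comp (g := s) (f := Prod.fst) hs analyticAt_fst
  have hs'f : AnalyticAt ℂ (fun p : ℂ × ℂ => deriv s p.1) 0 :=
    AnalyticAt.fun_comp (g := deriv s) (f := Prod.fst) hs.deriv analyticAt_fst
  have htr : ∀ {F : ℂ × ℂ → ℂ}, AnalyticAt ℂ F 0 →
      AnalyticAt ℂ (fun p : ℂ × ℂ => F (p.1, p.2 + s p.1)) 0 := fun hF =>
    analyticAt_comp_prodMk_zero hF analyticAt_fst (analyticAt_snd.add hsf) rfl (by simp [hs0])
  have hA₁a : AnalyticAt ℂ A₁ 0 := htr hA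
  have hB₁a : AnalyticAt ℂ B₁ 0 := (htr hB).sub ((analyticAt_fst.mul hs'f).mul (htr hA))
  obtain ⟨a, R, ha, ha0, hR, hR0, hAdec⟩ := exists_sum_add_pow_mul (J + 1) hA₁a hg
    (by simpa [hA₁, hs0] using hAg)
  obtain ⟨b, Q, hb, hb0, hQ, hQ0, hBdec⟩ := exists_sum_add_pow_mul (J + 2) hB₁a hh
    (by simpa [hB₁, hs0] using hBh)
  have haJ : ∀ᶠ x in 𝓝 (0 : ℂ), a J x = 0 := eventually_coeff_eq_zero hR hAdec hsA
  set S : Finset (ℕ ⊕ ℕ) := (Finset.range (J + 1)).disjSum (Finset.range (J + 2)) with hS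
  have hSl : ∀ k, Sum.inl k ∈ S ↔ k < J + 1 := by simp [hS]
  have hSr : ∀ k, Sum.inr k ∈ S ↔ k < J + 2 := by simp [hS]
  by_cases hzero : ∀ i ∈ S, ∀ᶠ x in 𝓝 (0 : ℂ), (Sum.elim a b i) x = 0
  · refine ⟨1, fun _ => 0, one_ne_zero, analyticAt_const, rfl, ?_⟩
    filter_upwards [hzero (Sum.inr 0) ((hSr 0).mpr (by omega)), eventually_comp_prodMk hBdec
      (u := fun x : ℂ => x) (v := fun _ => 0) continuousAt_id continuousAt_const rfl rfl]
      with t h1 h2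
    have h1' : b 0 t = 0 := h1
    rw [pow_one, h2, Finset.sum_range_succ']
    simp [h1']
  have hne : ∃ i ∈ S, ¬ ∀ᶠ x in 𝓝 (0 : ℂ), (Sum.elim a b i) x = 0 := by
    by_contra hcon
    exact hzero fun i hi => by_contra fun h => hcon ⟨i, hi, h⟩
  obtain ⟨p, q, F, hp, hq, hF, hFe, hFne⟩ := exists_slope S (Sum.elim a b)
    (Sum.elim (fun k => J + 1 - k) (fun k => J + 2 - k))
    (by rintro (k | k) - <;> simp [ha, hb]) (by rintro (k | k) - <;> simp [ha0, hb0])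
    (by
      rintro (k | k) hk
      · have := (hSl k).mp hk
        simp only [Sum.elim_inl]; omega
      · have := (hSr k).mp hk
        simp only [Sum.elim_inr]; omega)
    hne
  set α : ℕ → ℂ → ℂ := fun k => F (Sum.inl k)
  set β : ℕ → ℂ → ℂ := fun k => F (Sum.inr k)
  have hα : ∀ k < J + 1, AnalyticAt ℂ (α k) 0 := fun k hk => hF _ ((hSl k).mpr hk)
  have hβ : ∀ k < J + 2, AnalyticAt ℂ (β k) 0 := fun k hk => hF _ ((hSr k).mpr hk)
  have hαe : ∀ k < J + 1, ∀ᶠ t in 𝓝 (0 : ℂ), a k (t ^ p) = t ^ (q * (J + 1 - k)) * α k t :=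
    fun k hk => hFe _ ((hSl k).mpr hk)
  have hβe : ∀ k < J + 2, ∀ᶠ t in 𝓝 (0 : ℂ), b k (t ^ p) = t ^ (q * (J + 2 - k)) * β k t :=
    fun k hk => hFe _ ((hSr k).mpr hk)
  have hpow : Tendsto (fun t : ℂ => t ^ p) (𝓝 0) (𝓝 0) :=
    (continuous_pow p).tendsto' 0 0 (zero_pow hp)
  have hαJ : α J 0 = 0 := by
    refine ((hα J (Nat.lt_succ_self J)).eventually_eq_zero_of_punctured ?_).self_of_nhds
    filter_upwards [eventually_mem_nhdsWithin, ((hpow.eventually haJ).and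
      (hαe J (Nat.lt_succ_self J))).filter_mono nhdsWithin_le_nhds] with t ht0 ht
    exact (mul_eq_zero.mp (ht.2.symm.trans ht.1)).resolve_left (pow_ne_zero _ ht0)
  obtain ⟨c, J', N₁, P₁, hJ', hN, hP, hN₁, hNP⟩ := exists_reduced_root (J := J)
    (α := fun k => α k 0) (β := fun k => β k 0) hp hq hg0 hr hαJ (by
      obtain ⟨k | k, hk, hk0⟩ := hFne
      · exact Or.inl ⟨k, (hSl k).mp hk, hk0⟩
      · exact Or.inr ⟨k, (hSr k).mp hk, hk0⟩)
  set A₃ : ℂ × ℂ → ℂ := fun v => ∑ k ∈ Finset.range (J + 1), α k v.1 * (c + v.2) ^ k +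
    (c + v.2) ^ (J + 1) * R (v.1 ^ p, v.1 ^ q * (c + v.2)) with hA₃
  set B₃ : ℂ × ℂ → ℂ := fun v => p * (∑ k ∈ Finset.range (J + 2), β k v.1 * (c + v.2) ^ k +
    (c + v.2) ^ (J + 2) * Q (v.1 ^ p, v.1 ^ q * (c + v.2))) - q * (c + v.2) * A₃ v with hB₃
  have hcv : AnalyticAt ℂ (fun v : ℂ × ℂ => c + v.2) 0 := analyticAt_const.add analyticAt_snd
  have hsub : ∀ {G : ℂ × ℂ → ℂ}, AnalyticAt ℂ G 0 →
      AnalyticAt ℂ (fun v : ℂ × ℂ => G (v.1 ^ p, v.1 ^ q * (c + v.2))) 0 := fun hG =>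
    analyticAt_comp_prodMk_zero hG (analyticAt_fst.pow p) ((analyticAt_fst.pow q).mul hcv)
      (by simp [hp]) (by simp [hq])
  have hsum : ∀ {K : ℕ} {γ : ℕ → ℂ → ℂ}, (∀ k < K, AnalyticAt ℂ (γ k) 0) →
      AnalyticAt ℂ (fun v : ℂ × ℂ => ∑ k ∈ Finset.range K, γ k v.1 * (c + v.2) ^ k) 0 :=
    fun {K γ} hγ => Finset.analyticAt_fun_sum _ fun k hk =>
      (AnalyticAt.fun_comp (g := γ k) (f := Prod.fst) (hγ k (Finset.mem_range.mp hk))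
        analyticAt_fst).mul (hcv.pow k)
  have hA₃a : AnalyticAt ℂ A₃ 0 := (hsum hα).add ((hcv.pow _).mul (hsub hR))
  have hB₃a : AnalyticAt ℂ B₃ 0 :=
    (analyticAt_const.mul ((hsum hβ).add ((hcv.pow _).mul (hsub hQ)))).sub
      ((analyticAt_const.mul hcv).mul hA₃a)
  have hA₃0 : ∀ y, A₃ (0, y) = y ^ J' * N₁.eval (c + y) := by
    intro y
    have := congrArg (Polynomial.eval (c + y)) hN
    rw [eval_newtonPoly] at this
    simp only [hA₃, zero_pow hp, zero_pow hq, zero_mul]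
    rw [show R (0, 0) = g 0 from hR0, mul_comm _ (g 0), this]
    simp
  have hB₃0 : ∀ y, B₃ (0, y) = y ^ (J' + 1) * P₁.eval (c + y) := by
    intro y
    have h1 := congrArg (Polynomial.eval (c + y)) hP
    have h2 := congrArg (Polynomial.eval (c + y)) hN
    have h3 := hA₃0 y
    simp only [Polynomial.eval_sub, Polynomial.eval_mul, Polynomial.eval_C, Polynomial.eval_X,
      Polynomial.eval_pow, add_sub_cancel_left] at h1 h2
    rw [eval_newtonPoly, h2, ← h3] at h1
    rw [← h1, hB₃]
    simp only [zero_pow hp, zero_pow hq, zero_mul]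
    rw [show Q (0, 0) = h 0 from hQ0, mul_comm _ (h 0)]
  have hpoly : ∀ T : Polynomial ℂ, AnalyticAt ℂ (fun y => T.eval (c + y)) 0 := fun T =>
    AnalyticAt.fun_comp (g := fun u => T.eval u) (f := fun y => c + y)
      (T.differentiable.analyticAt _) (by fun_prop)
  obtain ⟨n, ψ, hψ⟩ := ih J' hJ' hA₃a hB₃a (hpoly N₁) (hpoly P₁)
    (Eventually.of_forall hA₃0) (Eventually.of_forall hB₃0) (by simpa using hN₁)
    (by simpa using hNP)
  refine ⟨n * p, _, hψ.of_blowup (A := A₁) (B := B₁) (J := J + 1) (c := c) hp hq ?_ ?_⟩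
  · have h1 : ∀ᶠ t in 𝓝 (0 : ℂ), ∀ k ∈ Finset.range (J + 1),
        a k (t ^ p) = t ^ (q * (J + 1 - k)) * α k t :=
      (eventually_all_finset _).mpr fun k hk => hαe k (Finset.mem_range.mp hk)
    filter_upwards [(continuous_fst.tendsto' (0 : ℂ × ℂ) 0 rfl).eventually h1,
      eventually_comp_prodMk hAdec (u := fun v : ℂ × ℂ => v.1 ^ p)
        (v := fun v => v.1 ^ q * (c + v.2)) (z := 0) (by fun_prop) (by fun_prop)
        (by simp [hp]) (by simp [hq])] with v h2 h3
    rw [h3]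
    change _ = v.1 ^ (q * (J + 1)) * (∑ k ∈ Finset.range (J + 1), α k v.1 * (c + v.2) ^ k +
      (c + v.2) ^ (J + 1) * R (v.1 ^ p, v.1 ^ q * (c + v.2)))
    rw [mul_add (v.1 ^ (q * (J + 1))), Finset.mul_sum, mul_pow, ← pow_mul]
    congr 1
    · refine Finset.sum_congr rfl fun k hk => ?_
      have hk' := Finset.mem_range.mp hk
      rw [h2 k hk, mul_pow, ← pow_mul,
        show q * (J + 1) = q * (J + 1 - k) + q * k by rw [← mul_add, Nat.sub_add_cancel hk'.le],
        pow_add]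
      ring
    · ring
  · have h1 : ∀ᶠ t in 𝓝 (0 : ℂ), ∀ k ∈ Finset.range (J + 2),
        b k (t ^ p) = t ^ (q * (J + 2 - k)) * β k t :=
      (eventually_all_finset _).mpr fun k hk => hβe k (Finset.mem_range.mp hk)
    filter_upwards [(continuous_fst.tendsto' (0 : ℂ × ℂ) 0 rfl).eventually h1,
      eventually_comp_prodMk hBdec (u := fun v : ℂ × ℂ => v.1 ^ p)
        (v := fun v => v.1 ^ q * (c + v.2)) (z := 0) (by fun_prop) (by fun_prop)
        (by simp [hp]) (by simp [hq])] with v h2 h3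
    rw [h3, hB₃, sub_add_cancel, mul_left_comm]
    congr 1
    rw [mul_add (v.1 ^ (q * (J + 1 + 1))), Finset.mul_sum, mul_pow, ← pow_mul]
    congr 1
    · refine Finset.sum_congr rfl fun k hk => ?_
      have hk' := Finset.mem_range.mp hk
      rw [h2 k hk, mul_pow, ← pow_mul,
        show q * (J + 1 + 1) = q * (J + 2 - k) + q * k by
          rw [← mul_add, Nat.sub_add_cancel hk'.le],
        pow_add]
      ring
    · ring

theorem exists_separatrix (a b : ℂ × ℂ → ℂ) (ha : AnalyticAt ℂ a 0) (hb : AnalyticAt ℂ b 0) :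
    ∃ f : ℂ × ℂ → ℂ, Separatrix a b f := by
  by_cases h : ∀ᶠ y in 𝓝 (0 : ℂ), b (0, y) = 0
  · exact ⟨_, separatrix_fst hb h⟩
  have hby : AnalyticAt ℂ (fun y => b (0, y)) 0 :=
    analyticAt_comp_prodMk_zero hb analyticAt_const analyticAt_id rfl rfl
  obtain ⟨J, g, hg, hg0, hge⟩ := hby.exists_eventuallyEq_pow_smul_nonzero_iff.mpr h
  refine separatrix_of_puiseuxSolution ha hb (exists_puiseuxSolution J (g := fun y => -g y)
    (h := fun _ => 0) hb.neg (analyticAt_fst.mul ha) hg.neg analyticAt_const ?_ ?_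
    (neg_ne_zero.mpr hg0) ?_)
  · filter_upwards [hge] with y hy
    rw [hy]; simp
  · simp
  · intro r hr0 h0
    have : (r : ℂ) ≠ 0 := by exact_mod_cast hr0.ne'
    exact mul_ne_zero this (neg_ne_zero.mpr hg0) h0.symm

end

/-- **Camacho–Sad.** Every singular holomorphic foliation germ at `(ℂ²,0)`,
given by `ω = a dx + b dy` with `a, b` holomorphic coprime germs vanishing at `0`, admits at
least one separatrix: an irreducible analytic invariant curve germ through the origin. -/
theorem camacho_sad_separatrix
    (a b : ℂ × ℂ → ℂ) (ha : AnalyticAt ℂ a 0) (hb : AnalyticAt ℂ b 0)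
    (ha0 : a 0 = 0) (hb0 : b 0 = 0)
    (hcop : ¬ ∃ c : ℂ × ℂ → ℂ, AnalyticAt ℂ c 0 ∧ c 0 = 0 ∧ DivGermAt c a 0 ∧ DivGermAt c b 0) :
    ∃ f : ℂ × ℂ → ℂ, Separatrix a b f := by
  exact exists_separatrix a b ha hb
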